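/- arXiv:1603.02658 — 2 statements merged into one kernel-verified Lean document; each statement's English description precedes it below -/
import Mathlib

section
/- Well-posedness of the linearly implicit step (Lemma 4.1, first part): let 0 < R ≤ 1/4. There exists τ₀ > 0 such that for every τ ∈ (0, τ₀] and every even function ψ : ℝ → ℝ, differentiable with ψ, ψ' square-integrable, with ∫_ℝ ψ² = 1 and ‖ψ − η‖_{H¹} < R, there exists a unique even function ψ* : ℝ → ℝ, twice differentiable with ψ*, ψ*', ψ*'' square-integrable, satisfying ψ*(x) = ψ(x) + τ·( (1/2)·ψ*''(x) + ψ(x)²·ψ*(x) ) for all x; moreover ‖ψ*‖_{L²} > 0 and the normalized function ψ⁺ := ψ*/‖ψ*‖_{L²} satisfies ∫_ℝ (ψ⁺)² = 1 and ‖ψ⁺ − η‖_{H¹} < 2R. -/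
open MeasureTheory

/-- The ground state `η(x) = (1/2) sech(x/2)`. -/
noncomputable def eta (x : ℝ) : ℝ := (1/2) * (1 / Real.cosh (x/2))

/-- Squared `H¹` norm: `‖f‖_{H¹}² = ∫ (f² + f'²)`. -/
noncomputable def H1sq (f : ℝ → ℝ) : ℝ := ∫ x : ℝ, ((f x)^2 + (deriv f x)^2)

/-- `φ` is an admissible solution of the linearly implicit step with data `ψ` and step `τ`:
even, twice differentiable with `φ, φ', φ''` square-integrable, and
`φ = ψ + τ((1/2)φ'' + ψ²φ)` pointwise. -/
def ImplicitStep (τ : ℝ) (ψ φ : ℝ → ℝ) : Prop :=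
  (∀ x, φ (-x) = φ x) ∧ Differentiable ℝ φ ∧ Differentiable ℝ (deriv φ) ∧
  Integrable (fun x => (φ x)^2) ∧ Integrable (fun x => (deriv φ x)^2) ∧
  Integrable (fun x => (deriv (deriv φ) x)^2) ∧
  ∀ x : ℝ, φ x = ψ x + τ * ((1/2) * deriv (deriv φ) x + (ψ x)^2 * φ x)

lemma integral_mul_deriv_eq_neg {u v u' v' : ℝ → ℝ} (hu : ∀ x, HasDerivAt u (u' x) x)
    (hv : ∀ x, HasDerivAt v (v' x) x) (mu : MemLp u 2) (mu' : MemLp u' 2)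
    (mv : MemLp v 2) (mv' : MemLp v' 2) :
    ∫ x, u x * v' x = -∫ x, u' x * v x :=
  integral_mul_deriv_eq_deriv_mul_of_integrable (fun x _ => hu x) (fun x _ => hv x)
    (mu.integrable_mul mv') (mu'.integrable_mul mv) (mu.integrable_mul mv)

lemma sq_le_integral_sq_add_sq {f f' : ℝ → ℝ} (hf : ∀ x, HasDerivAt f (f' x) x)
    (m : MemLp f 2) (m' : MemLp f' 2) (x : ℝ) : f x ^ 2 ≤ ∫ y, (f y ^ 2 + f' y ^ 2) := by
  have hi : Integrable (fun y => f y ^ 2 + f' y ^ 2) := m.integrable_sq.add m'.integrable_sq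
  have hd : ∀ y, HasDerivAt (fun y => f y ^ 2) (2 * (f y * f' y)) y := fun y => by
    have := (hf y).pow 2
    exact this.congr_deriv (by simp; ring)
  have hi' : Integrable (fun y => 2 * (f y * f' y)) := (m.integrable_mul m').const_mul 2
  have ht := tendsto_zero_of_hasDerivAt_of_integrableOn_Iic (a := x)
    (fun y _ => hd y) hi'.integrableOn m.integrable_sq.integrableOn
  have h1 := integral_Iic_of_hasDerivAt_of_tendsto' (a := x) (fun y _ => hd y) hi'.integrableOn ht
  calc f x ^ 2 = ∫ y in Set.Iic x, 2 * (f y * f' y) := by rw [h1, sub_zero]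
    _ ≤ ∫ y in Set.Iic x, (f y ^ 2 + f' y ^ 2) :=
        integral_mono hi'.integrableOn hi.integrableOn
          fun y => by nlinarith [sq_nonneg (f y - f' y)]
    _ ≤ _ := setIntegral_le_integral hi (Filter.Eventually.of_forall fun y => by positivity)

/-- The decaying solution of `a' = f - k a`. -/
noncomputable def leftGreen (k : ℝ) (f : ℝ → ℝ) (x : ℝ) : ℝ :=
  Real.exp (-(k * x)) * ∫ y in Set.Iic x, Real.exp (k * y) * f y

section leftGreen

variable {k M : ℝ} {f g : ℝ → ℝ}

lemma integrableOn_exp_mul (hk : 0 < k) (hf : Continuous f) (hM : ∀ x, |f x| ≤ M) (x : ℝ) :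
    IntegrableOn (fun y => Real.exp (k * y) * f y) (Set.Iic x) :=
  (integrableOn_exp_mul_Iic hk x).mul_bdd (c := M) hf.aestronglyMeasurable
    (Filter.Eventually.of_forall fun y => hM y)

lemma hasDerivAt_leftGreen (hk : 0 < k) (hf : Continuous f) (hM : ∀ x, |f x| ≤ M) (x : ℝ) :
    HasDerivAt (leftGreen k f) (f x - k * leftGreen k f x) x := by
  have hc : Continuous fun y => Real.exp (k * y) * f y := by fun_prop
  have h1 : HasDerivAt (fun x => ∫ y in Set.Iic x, Real.exp (k * y) * f y)
      (Real.exp (k * x) * f x) x := by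
    have h := (hc.integral_hasStrictDerivAt 0 x).hasDerivAt.const_add
      (∫ y in Set.Iic 0, Real.exp (k * y) * f y)
    refine h.congr_of_eventuallyEq (Filter.Eventually.of_forall fun z => ?_)
    have := intervalIntegral.integral_Iic_sub_Iic
      (integrableOn_exp_mul hk hf hM 0) (integrableOn_exp_mul hk hf hM z)
    dsimp only at *
    linarith
  have h2 : HasDerivAt (fun x => Real.exp (-(k * x))) (Real.exp (-(k * x)) * -k) x := by
    have := ((hasDerivAt_id x).const_mul k).neg.exp
    simpa using this
  refine (h2.mul h1).congr_deriv ?_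
  rw [leftGreen, ← mul_assoc (Real.exp (-(k * x))), ← Real.exp_add]
  simp
  ring

lemma abs_leftGreen_le (hk : 0 < k) (hf : Continuous f) (hM : ∀ x, |f x| ≤ M) (x : ℝ) :
    |leftGreen k f x| ≤ M / k := by
  have h1 : |∫ y in Set.Iic x, Real.exp (k * y) * f y| ≤ ∫ y in Set.Iic x, Real.exp (k * y) * M :=
    (abs_integral_le_integral_abs).trans <|
      integral_mono (integrableOn_exp_mul hk hf hM x).abs
        ((integrableOn_exp_mul_Iic hk x).mul_const M) fun y => by
          simp only [abs_mul, Real.abs_exp]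
          exact mul_le_mul_of_nonneg_left (hM y) (Real.exp_pos _).le
  rw [integral_mul_const, integral_exp_mul_Iic hk] at h1
  rw [leftGreen, abs_mul, Real.abs_exp]
  refine (mul_le_mul_of_nonneg_left h1 (Real.exp_pos _).le).trans_eq ?_
  rw [Real.exp_neg]
  field_simp

lemma leftGreen_sub (hk : 0 < k) {M' : ℝ} (hf : Continuous f) (hM : ∀ x, |f x| ≤ M)
    (hg : Continuous g) (hM' : ∀ x, |g x| ≤ M') (x : ℝ) :
    leftGreen k f x - leftGreen k g x = leftGreen k (fun y => f y - g y) x := by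
  simp only [leftGreen, mul_sub]
  rw [integral_sub (integrableOn_exp_mul hk hf hM x) (integrableOn_exp_mul hk hg hM' x), mul_sub]

lemma memLp_leftGreen (hk : 0 < k) (hf : Continuous f) (hM : ∀ x, |f x| ≤ M)
    (m : MemLp f 2) : MemLp (leftGreen k f) 2 := by
  set a := leftGreen k f with ha
  have hd := hasDerivAt_leftGreen hk hf hM
  have hc : Continuous a := continuous_iff_continuousAt.2 fun x => (hd x).continuousAt
  refine (memLp_two_iff_integrable_sq hc.aestronglyMeasurable).2 ?_
  refine integrable_of_intervalIntegral_norm_bounded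
    (((∫ x, f x ^ 2) / k + (M / k) ^ 2) / k) (a := fun n : ℕ => -(n : ℝ)) (b := fun n : ℕ => (n : ℝ))
    (l := Filter.atTop) (fun n => (by fun_prop : Continuous fun x => a x ^ 2).integrableOn_Ioc)
    (Filter.tendsto_neg_atTop_atBot.comp tendsto_natCast_atTop_atTop)
    tendsto_natCast_atTop_atTop (Filter.Eventually.of_forall fun n => ?_)
  have hn : -(n : ℝ) ≤ n := by have : (0 : ℝ) ≤ n := n.cast_nonneg; linarith
  have hsq : ∀ x, HasDerivAt (fun x => a x ^ 2) (2 * a x * (f x - k * a x)) x := fun x =>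
    ((hd x).pow 2).congr_deriv (by simp [ha])
  have hI := intervalIntegral.integral_eq_sub_of_hasDerivAt (a := -(n : ℝ)) (b := n)
    (fun x _ => hsq x) (Continuous.intervalIntegrable (by fun_prop) _ _)
  have h1 : ∫ x in (-(n : ℝ))..n, k * a x ^ 2 ≤
      ∫ x in (-(n : ℝ))..n, (f x ^ 2 / k - 2 * a x * (f x - k * a x)) := by
    refine intervalIntegral.integral_mono_on hn (Continuous.intervalIntegrable (by fun_prop) _ _)
      (Continuous.intervalIntegrable (by fun_prop) _ _) fun x _ => ?_
    have : 0 ≤ (f x - k * a x) ^ 2 / k := by positivity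
    have h : (f x - k * a x) ^ 2 / k = f x ^ 2 / k - 2 * a x * f x + k * a x ^ 2 := by
      field_simp
      ring
    nlinarith
  rw [intervalIntegral.integral_sub (Continuous.intervalIntegrable (by fun_prop) _ _)
    (Continuous.intervalIntegrable (by fun_prop) _ _), hI, intervalIntegral.integral_const_mul,
    intervalIntegral.integral_div] at h1
  have h2 : ∫ x in (-(n : ℝ))..n, f x ^ 2 ≤ ∫ x, f x ^ 2 := by
    rw [intervalIntegral.integral_of_le hn]
    exact setIntegral_le_integral m.integrable_sq
      (Filter.Eventually.of_forall fun y => by positivity)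
  have h3 : a (-(n : ℝ)) ^ 2 ≤ (M / k) ^ 2 := by
    rw [← sq_abs]
    exact pow_le_pow_left₀ (abs_nonneg _) (abs_leftGreen_le hk hf hM _) 2
  have h4 : (∫ x in (-(n : ℝ))..n, f x ^ 2) / k ≤ (∫ x, f x ^ 2) / k := by gcongr
  rw [le_div_iff₀ hk]
  simp only [norm_pow, Real.norm_eq_abs, sq_abs]
  nlinarith [sq_nonneg (a n)]

end leftGreen

/-- The resolvent `(1 - k⁻² ∂²)⁻¹` on the line. -/
noncomputable def lineResolvent (k : ℝ) (f : ℝ → ℝ) (x : ℝ) : ℝ :=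
  k / 2 * (leftGreen k f x + leftGreen k (fun y => f (-y)) (-x))

section lineResolvent

variable {k M : ℝ} {f g : ℝ → ℝ}

lemma hasDerivAt_leftGreen_neg (hk : 0 < k) (hf : Continuous f) (hM : ∀ x, |f x| ≤ M) (x : ℝ) :
    HasDerivAt (fun x => leftGreen k (fun y => f (-y)) (-x))
      (k * leftGreen k (fun y => f (-y)) (-x) - f x) x := by
  have h := (hasDerivAt_leftGreen hk (hf.comp continuous_neg) (fun x => hM (-x)) (-x)).comp x
    (hasDerivAt_neg x)
  refine h.congr_deriv ?_
  simp [Function.comp_def]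

lemma hasDerivAt_lineResolvent (hk : 0 < k) (hf : Continuous f) (hM : ∀ x, |f x| ≤ M) (x : ℝ) :
    HasDerivAt (lineResolvent k f)
      (k ^ 2 / 2 * (leftGreen k (fun y => f (-y)) (-x) - leftGreen k f x)) x :=
  (((hasDerivAt_leftGreen hk hf hM x).add (hasDerivAt_leftGreen_neg hk hf hM x)).const_mul
    (k / 2)).congr_deriv (by ring)

lemma hasDerivAt_deriv_lineResolvent (hk : 0 < k) (hf : Continuous f) (hM : ∀ x, |f x| ≤ M) (x : ℝ) :
    HasDerivAt (deriv (lineResolvent k f)) (k ^ 2 * (lineResolvent k f x - f x)) x := by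
  rw [funext fun x => (hasDerivAt_lineResolvent hk hf hM x).deriv]
  exact (((hasDerivAt_leftGreen_neg hk hf hM x).sub (hasDerivAt_leftGreen hk hf hM x)).const_mul
    (k ^ 2 / 2)).congr_deriv (by rw [lineResolvent]; ring)

lemma abs_lineResolvent_le (hk : 0 < k) (hf : Continuous f) (hM : ∀ x, |f x| ≤ M) (x : ℝ) :
    |lineResolvent k f x| ≤ M := by
  have h1 := abs_leftGreen_le hk hf hM x
  have h2 := abs_leftGreen_le hk (hf.comp continuous_neg) (fun x => hM (-x)) (-x)
  rw [lineResolvent, abs_mul, abs_of_pos (by positivity)]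
  calc k / 2 * _ ≤ k / 2 * (M / k + M / k) := by
        gcongr
        exact (abs_add_le _ _).trans (add_le_add h1 h2)
    _ = M := by field_simp; ring

lemma lineResolvent_sub (hk : 0 < k) {M' : ℝ} (hf : Continuous f) (hM : ∀ x, |f x| ≤ M)
    (hg : Continuous g) (hM' : ∀ x, |g x| ≤ M') (x : ℝ) :
    lineResolvent k f x - lineResolvent k g x = lineResolvent k (fun y => f y - g y) x := by
  have h1 := leftGreen_sub hk hf hM hg hM' x
  have h2 := leftGreen_sub hk (hf.comp continuous_neg) (fun x => hM (-x))
    (hg.comp continuous_neg) (fun x => hM' (-x)) (-x)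
  simp only [Function.comp_def] at h2
  rw [lineResolvent, lineResolvent, lineResolvent, ← h1, ← h2]
  ring

lemma memLp_leftGreen_neg (hk : 0 < k) (hf : Continuous f) (hM : ∀ x, |f x| ≤ M)
    (m : MemLp f 2) : MemLp (fun x => leftGreen k (fun y => f (-y)) (-x)) 2 :=
  (memLp_leftGreen hk (hf.comp continuous_neg) (fun x => hM (-x))
    (m.comp_measurePreserving (Measure.measurePreserving_neg volume))).comp_measurePreserving
      (Measure.measurePreserving_neg volume)

lemma memLp_lineResolvent (hk : 0 < k) (hf : Continuous f) (hM : ∀ x, |f x| ≤ M)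
    (m : MemLp f 2) : MemLp (lineResolvent k f) 2 :=
  ((memLp_leftGreen hk hf hM m).add (memLp_leftGreen_neg hk hf hM m)).const_mul (k / 2)

lemma memLp_deriv_lineResolvent (hk : 0 < k) (hf : Continuous f) (hM : ∀ x, |f x| ≤ M)
    (m : MemLp f 2) : MemLp (deriv (lineResolvent k f)) 2 := by
  rw [funext fun x => (hasDerivAt_lineResolvent hk hf hM x).deriv]
  exact ((memLp_leftGreen_neg hk hf hM m).sub (memLp_leftGreen hk hf hM m)).const_mul (k ^ 2 / 2)

end lineResolvent

lemma exists_fixedPoint_lineResolvent {k τ B : ℝ} (hk : 0 < k) (hτ : 0 < τ) {ψ : ℝ → ℝ}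
    (hψ : Continuous ψ) (hB : ∀ x, ψ x ^ 2 ≤ B) (hτB : τ * B < 1) :
    ∃ (u : ℝ → ℝ) (C : ℝ), Continuous u ∧ (∀ x, |u x| ≤ C) ∧
      u = lineResolvent k (fun x => ψ x + τ * (ψ x ^ 2 * u x)) := by
  have hB0 : 0 ≤ B := (sq_nonneg _).trans (hB 0)
  have hc : ∀ u : BoundedContinuousFunction ℝ ℝ,
      Continuous fun x => ψ x + τ * (ψ x ^ 2 * u x) := fun u => by fun_prop
  have hd : ∀ u v : BoundedContinuousFunction ℝ ℝ, ∀ x,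
      |τ * (ψ x ^ 2 * u x) - τ * (ψ x ^ 2 * v x)| ≤ τ * B * dist u v := fun u v x => by
    have h := u.dist_coe_le_dist (g := v) x
    rw [Real.dist_eq] at h
    rw [← mul_sub, ← mul_sub, abs_mul, abs_mul, abs_of_pos hτ, abs_of_nonneg (sq_nonneg _),
      mul_assoc]
    gcongr
    exact hB x
  have hb : ∀ u : BoundedContinuousFunction ℝ ℝ, ∀ x,
      |ψ x + τ * (ψ x ^ 2 * u x)| ≤ √B + τ * B * dist u 0 := fun u x => by
    refine (abs_add_le _ _).trans (add_le_add (Real.abs_le_sqrt (hB x)) ?_)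
    simpa using hd u 0 x
  let Φ : BoundedContinuousFunction ℝ ℝ → BoundedContinuousFunction ℝ ℝ := fun u =>
    BoundedContinuousFunction.ofNormedAddCommGroup
      (lineResolvent k (fun x => ψ x + τ * (ψ x ^ 2 * u x)))
      (continuous_iff_continuousAt.2 fun x =>
        (hasDerivAt_lineResolvent hk (hc u) (hb u) x).continuousAt)
      (√B + τ * B * dist u 0) (abs_lineResolvent_le hk (hc u) (hb u))
  have hΦ : ContractingWith (Real.toNNReal (τ * B)) Φ := by
    refine ⟨by simpa using hτB, LipschitzWith.of_dist_le_mul fun u v => ?_⟩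
    rw [Real.coe_toNNReal _ (by positivity)]
    refine (BoundedContinuousFunction.dist_le (by positivity)).2 fun x => ?_
    rw [Real.dist_eq]
    change |lineResolvent k _ x - lineResolvent k _ x| ≤ _
    rw [lineResolvent_sub hk (hc u) (hb u) (hc v) (hb v)]
    refine abs_lineResolvent_le hk ((hc u).sub (hc v)) (fun y => ?_) x
    rw [Pi.sub_apply, add_sub_add_left_eq_sub]
    exact hd u v y
  let u := hΦ.fixedPoint
  have hu : Φ u = u := hΦ.fixedPoint_isFixedPt
  exact ⟨u, ‖u‖, u.continuous, u.norm_coe_le_norm,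
    (congrArg (fun v : BoundedContinuousFunction ℝ ℝ => (v : ℝ → ℝ)) hu).symm⟩

lemma exists_implicit_solution {τ B : ℝ} (hτ : 0 < τ) {ψ : ℝ → ℝ}
    (hψ : Continuous ψ) (m : MemLp ψ 2) (hB : ∀ x, ψ x ^ 2 ≤ B) (hτB : τ * B < 1) :
    ∃ u : ℝ → ℝ, Differentiable ℝ u ∧ Differentiable ℝ (deriv u) ∧ MemLp u 2 ∧
      MemLp (deriv u) 2 ∧ MemLp (deriv (deriv u)) 2 ∧
      ∀ x, u x = ψ x + τ * (1 / 2 * deriv (deriv u) x + ψ x ^ 2 * u x) := by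
  have hk : 0 < √(2 / τ) := by positivity
  have hk2 : √(2 / τ) ^ 2 = 2 / τ := Real.sq_sqrt (by positivity)
  obtain ⟨u, C, hu, hC, hfix⟩ := exists_fixedPoint_lineResolvent hk hτ hψ hB hτB
  have hB0 : 0 ≤ B := (sq_nonneg _).trans (hB 0)
  have hC0 : 0 ≤ C := (abs_nonneg _).trans (hC 0)
  set f := fun x => ψ x + τ * (ψ x ^ 2 * u x) with hf
  have hfc : Continuous f := by fun_prop
  have hψb : ∀ x, |ψ x ^ 2 * u x| ≤ B * C := fun x => by
    rw [abs_mul, abs_of_nonneg (sq_nonneg _)]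
    exact mul_le_mul (hB x) (hC x) (abs_nonneg _) hB0
  have hfb : ∀ x, |f x| ≤ √B + τ * (B * C) := fun x => by
    refine (abs_add_le _ _).trans (add_le_add (Real.abs_le_sqrt (hB x)) ?_)
    rw [abs_mul, abs_of_pos hτ]
    exact mul_le_mul_of_nonneg_left (hψb x) hτ.le
  have hfm : MemLp f 2 := by
    refine m.add (MemLp.const_mul ?_ τ)
    refine m.of_le_mul (c := √B * C) (by fun_prop) (Filter.Eventually.of_forall fun x => ?_)
    rw [Real.norm_eq_abs, Real.norm_eq_abs, abs_mul, pow_two, abs_mul]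
    nlinarith [mul_le_mul (Real.abs_le_sqrt (hB x)) (hC x) (abs_nonneg _) (Real.sqrt_nonneg _),
      abs_nonneg (ψ x)]
  have h2 := hasDerivAt_deriv_lineResolvent hk hfc hfb
  have mu := memLp_lineResolvent hk hfc hfb hfm
  have mu' := memLp_deriv_lineResolvent hk hfc hfb hfm
  have h1 := fun x => (hasDerivAt_lineResolvent hk hfc hfb x).differentiableAt
  rw [← hfix] at h1 h2 mu mu'
  refine ⟨u, h1, fun x => (h2 x).differentiableAt, mu, mu', ?_, fun x => ?_⟩
  · rw [funext fun x => (h2 x).deriv]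
    exact (mu.sub hfm).const_mul _
  · rw [(h2 x).deriv, hk2, hf]
    field_simp
    ring

/-- The derivative of `eta`. -/
noncomputable def etaDeriv (x : ℝ) : ℝ := -(1 / 2 * Real.sinh (x / 2) / Real.cosh (x / 2) * eta x)

lemma hasDerivAt_eta (x : ℝ) : HasDerivAt eta (etaDeriv x) x := by
  have hc : HasDerivAt (fun x => Real.cosh (x / 2)) (Real.sinh (x / 2) * (1 / 2)) x :=
    ((hasDerivAt_id x).div_const 2).cosh
  have h0 := (Real.cosh_pos (x / 2)).ne'
  refine (((hasDerivAt_const x (1 : ℝ)).div hc h0).const_mul (1 / 2)).congr_deriv ?_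
  rw [etaDeriv, eta]
  field_simp
  ring

lemma hasDerivAt_etaDeriv (x : ℝ) : HasDerivAt etaDeriv (eta x / 4 - 2 * eta x ^ 3) x := by
  have hc : HasDerivAt (fun x => Real.cosh (x / 2)) (Real.sinh (x / 2) * (1 / 2)) x :=
    ((hasDerivAt_id x).div_const 2).cosh
  have hs : HasDerivAt (fun x => Real.sinh (x / 2)) (Real.cosh (x / 2) * (1 / 2)) x :=
    ((hasDerivAt_id x).div_const 2).sinh
  have h0 := (Real.cosh_pos (x / 2)).ne'
  refine ((((hs.const_mul (1 / 2)).fun_div hc h0).mul (hasDerivAt_eta x)).neg).congr_deriv ?_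
  have h := Real.cosh_sq (x / 2)
  simp only [etaDeriv, eta]
  field_simp
  rw [show Real.sinh (x / 2) ^ 2 = Real.cosh (x / 2) ^ 2 - 1 by linarith]
  ring

lemma eta_nonneg (x : ℝ) : 0 ≤ eta x := by
  have := Real.cosh_pos (x / 2)
  rw [eta]
  positivity

lemma eta_le_half (x : ℝ) : eta x ≤ 1 / 2 := by
  have h : 1 / Real.cosh (x / 2) ≤ 1 := by
    rw [div_le_one (Real.cosh_pos _)]
    exact Real.one_le_cosh _
  rw [eta]
  linarith

lemma etaDeriv_sq_le (x : ℝ) : etaDeriv x ^ 2 ≤ eta x ^ 2 / 4 := by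
  have h : (Real.sinh (x / 2) / Real.cosh (x / 2)) ^ 2 ≤ 1 := by
    rw [div_pow, div_le_one (by positivity), Real.cosh_sq]
    linarith
  have : etaDeriv x ^ 2 =
      (Real.sinh (x / 2) / Real.cosh (x / 2)) ^ 2 * (eta x ^ 2 / 4) := by
    rw [etaDeriv]
    ring
  rw [this]
  exact mul_le_of_le_one_left (by positivity) h

lemma sq_deriv_etaDeriv_le (x : ℝ) : (eta x / 4 - 2 * eta x ^ 3) ^ 2 ≤ eta x ^ 2 := by
  have h0 := eta_nonneg x
  have h1 := eta_le_half x
  have h2 : eta x ^ 2 ≤ 1 / 4 := by nlinarith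
  have h3 : (1 / 4 - 2 * eta x ^ 2) ^ 2 ≤ 1 := by nlinarith [sq_nonneg (eta x)]
  calc (eta x / 4 - 2 * eta x ^ 3) ^ 2 = (1 / 4 - 2 * eta x ^ 2) ^ 2 * eta x ^ 2 := by ring
    _ ≤ _ := mul_le_of_le_one_left (sq_nonneg _) h3

lemma continuous_eta : Continuous eta :=
  continuous_iff_continuousAt.2 fun x => (hasDerivAt_eta x).continuousAt

lemma continuous_etaDeriv : Continuous etaDeriv :=
  continuous_iff_continuousAt.2 fun x => (hasDerivAt_etaDeriv x).continuousAt

lemma memLp_eta : MemLp eta 2 := by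
  refine (memLp_two_iff_integrable_sq continuous_eta.aestronglyMeasurable).2 ?_
  refine integrable_inv_one_add_sq.mono' (continuous_eta.pow 2).aestronglyMeasurable
    (Filter.Eventually.of_forall fun x => ?_)
  have hs : (x / 2) ^ 2 ≤ Real.sinh (x / 2) ^ 2 := by
    rw [← sq_abs, ← sq_abs (Real.sinh _), Real.abs_sinh]
    exact pow_le_pow_left₀ (abs_nonneg _) (Real.self_le_sinh_iff.2 (abs_nonneg _)) 2
  have hc := Real.cosh_sq (x / 2)
  have h : eta x ^ 2 = (4 * Real.cosh (x / 2) ^ 2)⁻¹ := by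
    rw [eta]
    ring
  rw [Real.norm_of_nonneg (sq_nonneg _), h]
  apply inv_anti₀ (by positivity)
  nlinarith

lemma memLp_etaDeriv : MemLp etaDeriv 2 :=
  memLp_eta.of_le continuous_etaDeriv.aestronglyMeasurable <| Filter.Eventually.of_forall fun x =>
    sq_le_sq.1 (by nlinarith [etaDeriv_sq_le x, sq_nonneg (eta x)])

lemma memLp_deriv_etaDeriv : MemLp (fun x => eta x / 4 - 2 * eta x ^ 3) 2 :=
  memLp_eta.of_le (by have := continuous_eta; fun_prop) <| Filter.Eventually.of_forall fun x =>
    sq_le_sq.1 (sq_deriv_etaDeriv_le x)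

lemma H1sq_eq_of_hasDerivAt {f f' : ℝ → ℝ} (hf : ∀ x, HasDerivAt f (f' x) x) :
    H1sq f = (∫ x, (f x ^ 2 + f' x ^ 2)) := by
  rw [H1sq, funext fun x => (hf x).deriv]

/-- Integration by parts: `u'' v + u' v'` is integrable with zero integral. -/
lemma integral_divergence_eq_zero {u' u'' v v' : ℝ → ℝ} (hu' : ∀ x, HasDerivAt u' (u'' x) x)
    (hv : ∀ x, HasDerivAt v (v' x) x) (mu' : MemLp u' 2) (mu'' : MemLp u'' 2)
    (mv : MemLp v 2) (mv' : MemLp v' 2) :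
    Integrable (fun x => u'' x * v x + u' x * v' x) ∧ (∫ x, (u'' x * v x + u' x * v' x)) = 0 := by
  have h1 : Integrable (fun x => u'' x * v x) := mu''.integrable_mul mv
  have h2 : Integrable (fun x => u' x * v' x) := mu'.integrable_mul mv'
  refine ⟨h1.add h2, ?_⟩
  rw [integral_add h1 h2, integral_mul_deriv_eq_neg hu' hv mu' mu'' mv mv', add_neg_cancel]

/-- `H¹` energy estimate for the step started at distance `d` from the ground state. -/
lemma energy_estimate {τ : ℝ} (hτ : 0 ≤ τ) {ψ w w' w'' d d' : ℝ → ℝ} (hψ : ∀ x, ψ x ^ 2 ≤ 9)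
    (hw : ∀ x, HasDerivAt w (w' x) x) (hw' : ∀ x, HasDerivAt w' (w'' x) x)
    (hd : ∀ x, HasDerivAt d (d' x) x) (mw : MemLp w 2) (mw' : MemLp w' 2) (mw'' : MemLp w'' 2)
    (md : MemLp d 2) (md' : MemLp d' 2)
    (heq : ∀ x, w x - d x =
      τ * (1 / 2 * (w'' x + (eta x / 4 - 2 * eta x ^ 3)) + ψ x ^ 2 * (w x + eta x))) :
    (∫ x, (w x ^ 2 + w' x ^ 2)) ≤ (∫ x, (d x ^ 2 + d' x ^ 2)) +
      τ * (487 * (∫ x, (w x ^ 2 + w' x ^ 2)) + 488 * (∫ x, eta x ^ 2)) := by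
  obtain ⟨i1, z1⟩ := integral_divergence_eq_zero hw' (fun x => (hw x).fun_sub (hd x)) mw' mw''
    (mw.sub md) (mw'.sub md')
  obtain ⟨i2, z2⟩ := integral_divergence_eq_zero hw' hw mw' mw'' mw mw'
  have iw : Integrable fun x => w x ^ 2 + w' x ^ 2 := mw.integrable_sq.fun_add mw'.integrable_sq
  have id : Integrable fun x => d x ^ 2 + d' x ^ 2 := md.integrable_sq.fun_add md'.integrable_sq
  have ie := memLp_eta.integrable_sq
  have hp : ∀ x, w x ^ 2 + w' x ^ 2 ≤ (d x ^ 2 + d' x ^ 2)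
      + (2 * (w'' x * (w x - d x) + w' x * (w' x - d' x))
      + (τ * (w'' x * w x + w' x * w' x)
      + τ * (487 * (w x ^ 2 + w' x ^ 2) + 488 * eta x ^ 2))) := fun x => by
    set e := eta x / 4 - 2 * eta x ^ 3
    have he : e ^ 2 ≤ eta x ^ 2 := sq_deriv_etaDeriv_le x
    set g := 1 / 2 * e + ψ x ^ 2 * (w x + eta x) with hg
    have h := heq x
    have h4 : (ψ x ^ 2) ^ 2 ≤ 81 := by nlinarith [hψ x, sq_nonneg (ψ x)]
    have hg2 : g ^ 2 ≤ 3 / 4 * eta x ^ 2 + 243 * (w x ^ 2 + eta x ^ 2) := by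
      have : g ^ 2 ≤ 3 * (1 / 4 * e ^ 2 + (ψ x ^ 2) ^ 2 * w x ^ 2 + (ψ x ^ 2) ^ 2 * eta x ^ 2) := by
        rw [hg]
        nlinarith [sq_nonneg (1 / 2 * e - ψ x ^ 2 * w x), sq_nonneg (1 / 2 * e - ψ x ^ 2 * eta x),
          sq_nonneg (ψ x ^ 2 * w x - ψ x ^ 2 * eta x)]
      nlinarith [mul_le_mul_of_nonneg_right h4 (sq_nonneg (w x)),
        mul_le_mul_of_nonneg_right h4 (sq_nonneg (eta x))]
    have hwd : w x - d x = τ * (1 / 2 * w'' x + g) := by rw [h, hg]; ring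
    have hq : 2 * (w x - w'' x) * (1 / 2 * w'' x + g) - (w'' x * w x + w' x * w' x)
        ≤ 487 * (w x ^ 2 + w' x ^ 2) + 488 * eta x ^ 2 := by
      nlinarith [sq_nonneg (w'' x + g), sq_nonneg (w x - g), sq_nonneg (w' x), sq_nonneg (eta x)]
    have hid : 2 * (w x - w'' x) * (w x - d x) =
        τ * (2 * (w x - w'' x) * (1 / 2 * w'' x + g)) := by rw [hwd]; ring
    nlinarith [mul_le_mul_of_nonneg_left hq hτ, sq_nonneg (w x - d x), sq_nonneg (w' x - d' x)]
  have i3 := ((iw.const_mul 487).fun_add (ie.const_mul 488)).const_mul τ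
  have i4 := (i2.const_mul τ).fun_add i3
  have i5 := (i1.const_mul 2).fun_add i4
  have hI := integral_mono iw (id.fun_add i5) hp
  rwa [integral_add id i5, integral_add (i1.const_mul 2) i4, integral_add (i2.const_mul τ) i3,
    integral_const_mul, integral_const_mul, integral_const_mul,
    integral_add (iw.const_mul 487) (ie.const_mul 488), integral_const_mul, integral_const_mul,
    z1, z2, mul_zero, mul_zero, zero_add, zero_add] at hI

/-- The squared mass changes by `O(τ)` in one step. -/
lemma abs_mass_sub_le {τ : ℝ} (hτ : 0 ≤ τ) {ψ ψ' u u' u'' : ℝ → ℝ} (hψ : ∀ x, ψ x ^ 2 ≤ 9)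
    (hdψ : ∀ x, HasDerivAt ψ (ψ' x) x) (hu : ∀ x, HasDerivAt u (u' x) x)
    (hu' : ∀ x, HasDerivAt u' (u'' x) x) (mψ : MemLp ψ 2) (mψ' : MemLp ψ' 2)
    (mu : MemLp u 2) (mu' : MemLp u' 2) (mu'' : MemLp u'' 2)
    (heq : ∀ x, u x = ψ x + τ * (1 / 2 * u'' x + ψ x ^ 2 * u x)) :
    |(∫ x, u x ^ 2) - ∫ x, ψ x ^ 2| ≤
      τ * (18 * (∫ x, (u x ^ 2 + u' x ^ 2)) + 9 * (∫ x, (ψ x ^ 2 + ψ' x ^ 2))) := by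
  obtain ⟨i1, z1⟩ := integral_divergence_eq_zero hu' (fun x => (hu x).fun_add (hdψ x)) mu' mu''
    (mu.add mψ) (mu'.add mψ')
  have iu : Integrable fun x => u x ^ 2 + u' x ^ 2 := mu.integrable_sq.fun_add mu'.integrable_sq
  have iψ : Integrable fun x => ψ x ^ 2 + ψ' x ^ 2 := mψ.integrable_sq.fun_add mψ'.integrable_sq
  have hp : ∀ x, |u x ^ 2 - ψ x ^ 2 - τ / 2 * (u'' x * (u x + ψ x) + u' x * (u' x + ψ' x))| ≤
      τ * (18 * (u x ^ 2 + u' x ^ 2) + 9 * (ψ x ^ 2 + ψ' x ^ 2)) := fun x => by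
    have hid : u x ^ 2 - ψ x ^ 2 - τ / 2 * (u'' x * (u x + ψ x) + u' x * (u' x + ψ' x)) =
        τ * (ψ x ^ 2 * (u x * (u x + ψ x)) - 1 / 2 * (u' x * (u' x + ψ' x))) := by
      linear_combination (u x + ψ x) * heq x
    rw [hid, abs_mul, abs_of_nonneg hτ]
    refine mul_le_mul_of_nonneg_left ((abs_sub _ _).trans ?_) hτ
    rw [abs_mul, abs_of_nonneg (sq_nonneg (ψ x)), abs_mul (1 / 2),
      abs_of_pos (by norm_num : (0 : ℝ) < 1 / 2)]
    have h1 : |u x * (u x + ψ x)| ≤ 2 * u x ^ 2 + ψ x ^ 2 :=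
      abs_le.2 ⟨by nlinarith [sq_nonneg (u x + ψ x)], by nlinarith [sq_nonneg (u x - ψ x)]⟩
    have h2 : |u' x * (u' x + ψ' x)| ≤ 2 * u' x ^ 2 + ψ' x ^ 2 :=
      abs_le.2 ⟨by nlinarith [sq_nonneg (u' x + ψ' x)], by nlinarith [sq_nonneg (u' x - ψ' x)]⟩
    have h3 := mul_le_mul (hψ x) h1 (abs_nonneg _) (by norm_num)
    nlinarith [sq_nonneg (u' x), sq_nonneg (ψ' x)]
  have i2 := (mu.integrable_sq.sub' mψ.integrable_sq).sub' (i1.const_mul (τ / 2))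
  have i3 := ((iu.const_mul 18).fun_add (iψ.const_mul 9)).const_mul τ
  have hI := (abs_integral_le_integral_abs).trans (integral_mono i2.abs i3 hp)
  have i4 := mu.integrable_sq.sub' mψ.integrable_sq
  rwa [integral_sub i4 (i1.const_mul (τ / 2)), integral_sub mu.integrable_sq mψ.integrable_sq,
    integral_const_mul, integral_const_mul, z1, mul_zero, sub_zero,
    integral_add (iu.const_mul 18) (iψ.const_mul 9), integral_const_mul, integral_const_mul] at hI

lemma eq_of_implicit_solutions {τ B : ℝ} (hτ : 0 < τ) (hτB : τ * B < 1) {ψ u v : ℝ → ℝ}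
    (hB : ∀ x, ψ x ^ 2 ≤ B) (hu : Differentiable ℝ u) (hu' : Differentiable ℝ (deriv u))
    (mu : MemLp u 2) (mu' : MemLp (deriv u) 2) (mu'' : MemLp (deriv (deriv u)) 2)
    (hv : Differentiable ℝ v) (hv' : Differentiable ℝ (deriv v))
    (mv : MemLp v 2) (mv' : MemLp (deriv v) 2) (mv'' : MemLp (deriv (deriv v)) 2)
    (equ : ∀ x, u x = ψ x + τ * (1 / 2 * deriv (deriv u) x + ψ x ^ 2 * u x))
    (eqv : ∀ x, v x = ψ x + τ * (1 / 2 * deriv (deriv v) x + ψ x ^ 2 * v x)) : u = v := by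
  obtain ⟨i1, z1⟩ := integral_divergence_eq_zero
    (fun x => (hu' x).hasDerivAt.fun_sub (hv' x).hasDerivAt)
    (fun x => (hu x).hasDerivAt.fun_sub (hv x).hasDerivAt) (mu'.sub mv') (mu''.sub mv'')
    (mu.sub mv) (mu'.sub mv')
  have is : Integrable fun x => (u x - v x) ^ 2 := (mu.sub mv).integrable_sq
  have hp : ∀ x, (1 - τ * B) * (u x - v x) ^ 2 ≤
      τ / 2 * ((deriv (deriv u) x - deriv (deriv v) x) * (u x - v x) +
        (deriv u x - deriv v x) * (deriv u x - deriv v x)) := fun x => by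
    have h1 : τ * (ψ x ^ 2 * (u x - v x) ^ 2) ≤ τ * (B * (u x - v x) ^ 2) := by
      gcongr
      exact hB x
    have h2 : 0 ≤ τ * (deriv u x - deriv v x) ^ 2 := by positivity
    linear_combination h1 + 1 / 2 * h2 + (u x - v x) * (equ x - eqv x)
  have hI := integral_mono (is.const_mul _) (i1.const_mul (τ / 2)) hp
  rw [integral_const_mul, integral_const_mul, z1] at hI
  have h0 : ∫ x, (u x - v x) ^ 2 = 0 := by
    have : 0 ≤ ∫ x, (u x - v x) ^ 2 := integral_nonneg fun x => sq_nonneg _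
    nlinarith
  have hae := (integral_eq_zero_iff_of_nonneg (fun x => sq_nonneg ((u x - v x))) is).1 h0
  have hc : Continuous fun x => (u x - v x) ^ 2 := (hu.sub hv).continuous.pow 2
  have := hc.ae_eq_iff_eq volume continuous_zero |>.1 hae
  funext x
  have hx := congrFun this x
  simpa [sub_eq_zero] using hx

/-- Normalizing a function that is `H¹`-close to `η` and has mass close to one. -/
lemma H1sq_normalize_le {N : ℝ} (hN : 0 < N) {w w' : ℝ → ℝ} (hw : ∀ x, HasDerivAt w (w' x) x)
    (mw : MemLp w 2) (mw' : MemLp w' 2) :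
    H1sq (fun x => (w x + eta x) / N - eta x) ≤ 2 / N ^ 2 * (∫ x, (w x ^ 2 + w' x ^ 2)) +
      2 * (1 / N - 1) ^ 2 * (∫ x, (eta x ^ 2 + etaDeriv x ^ 2)) := by
  have iw : Integrable fun x => w x ^ 2 + w' x ^ 2 := mw.integrable_sq.fun_add mw'.integrable_sq
  have ie : Integrable fun x => eta x ^ 2 + etaDeriv x ^ 2 :=
    memLp_eta.integrable_sq.fun_add memLp_etaDeriv.integrable_sq
  rw [H1sq_eq_of_hasDerivAt
    (fun x => (((hw x).fun_add (hasDerivAt_eta x)).div_const N).fun_sub (hasDerivAt_eta x)),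
    ← integral_const_mul, ← integral_const_mul,
    ← integral_add (iw.const_mul _) (ie.const_mul _)]
  refine integral_mono_of_nonneg (Filter.Eventually.of_forall fun x => by positivity)
    ((iw.const_mul _).fun_add (ie.const_mul _)) (Filter.Eventually.of_forall fun x => ?_)
  have key : ∀ a b : ℝ, ((a + b) / N - b) ^ 2 ≤
      2 / N ^ 2 * a ^ 2 + 2 * (1 / N - 1) ^ 2 * b ^ 2 := fun a b => by
    have : 0 ≤ (a / N - (1 / N - 1) * b) ^ 2 := sq_nonneg _
    have e : 2 / N ^ 2 * a ^ 2 + 2 * (1 / N - 1) ^ 2 * b ^ 2 - ((a + b) / N - b) ^ 2 =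
        (a / N - (1 / N - 1) * b) ^ 2 := by
      field_simp
      ring
    linarith
  have := key (w x) (eta x)
  have := key (w' x) (etaDeriv x)
  simp only
  linarith

lemma integral_sq_add_sq_le {f f' g g' h h' : ℝ → ℝ} (mf : MemLp f 2) (mf' : MemLp f' 2)
    (mg : MemLp g 2) (mg' : MemLp g' 2) (hh : ∀ x, h x = f x + g x)
    (hh' : ∀ x, h' x = f' x + g' x) :
    ∫ x, (h x ^ 2 + h' x ^ 2) ≤
      2 * (∫ x, (f x ^ 2 + f' x ^ 2)) + 2 * (∫ x, (g x ^ 2 + g' x ^ 2)) := by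
  have i1 := (mf.integrable_sq.fun_add mf'.integrable_sq).const_mul 2
  have i2 := (mg.integrable_sq.fun_add mg'.integrable_sq).const_mul 2
  rw [← integral_const_mul, ← integral_const_mul, ← integral_add i1 i2]
  refine integral_mono_of_nonneg (Filter.Eventually.of_forall fun x => by positivity)
    (i1.fun_add i2) (Filter.Eventually.of_forall fun x => ?_)
  simp only [hh, hh']
  nlinarith [sq_nonneg (f x - g x), sq_nonneg (f' x - g' x)]

/-- well-posedness of the linearly implicit step (Lemma 4.1, first part):
for `0 < R ≤ 1/4` there is `τ₀ > 0` such that for `0 < τ ≤ τ₀` and any even `H¹` function `ψ`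
on the unit `L²` sphere with `‖ψ − η‖_{H¹} < R`, the implicit step has a unique solution `ψ*`,
its `L²` norm is positive, and the normalization `ψ⁺ = ψ*/‖ψ*‖_{L²}` lies on the unit `L²`
sphere with `‖ψ⁺ − η‖_{H¹} < 2R`. -/
theorem implicit_step_wellposed (R : ℝ) (hR0 : 0 < R) (hR : R ≤ 1/4) :
    ∃ τ₀ : ℝ, 0 < τ₀ ∧
      ∀ τ : ℝ, 0 < τ → τ ≤ τ₀ →
      ∀ ψ : ℝ → ℝ, (∀ x, ψ (-x) = ψ x) → Differentiable ℝ ψ →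
        Integrable (fun x => (ψ x)^2) → Integrable (fun x => (deriv ψ x)^2) →
        (∫ x : ℝ, (ψ x)^2) = 1 →
        Real.sqrt (H1sq (fun x => ψ x - eta x)) < R →
        ∃ ψs : ℝ → ℝ, ImplicitStep τ ψ ψs ∧
          (∀ φ : ℝ → ℝ, ImplicitStep τ ψ φ → φ = ψs) ∧
          0 < Real.sqrt (∫ x : ℝ, (ψs x)^2) ∧
          (∫ x : ℝ, (ψs x / Real.sqrt (∫ y : ℝ, (ψs y)^2))^2) = 1 ∧
          Real.sqrt (H1sq
            (fun x => ψs x / Real.sqrt (∫ y : ℝ, (ψs y)^2) - eta x)) < 2 * R := by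
  refine ⟨R ^ 2 / 100000, by positivity, fun τ hτ hτ₀ ψ heven hdψ is is' hmass hdist => ?_⟩
  have hR2 : R ^ 2 ≤ 1 / 16 := by nlinarith
  have mψ : MemLp ψ 2 :=
    (memLp_two_iff_integrable_sq hdψ.continuous.aestronglyMeasurable).2 is
  have mψ' : MemLp (deriv ψ) 2 :=
    (memLp_two_iff_integrable_sq (measurable_deriv ψ).aestronglyMeasurable).2 is'
  have hψ1 := fun x => (hdψ x).hasDerivAt
  have hd1 : ∀ x, HasDerivAt (fun x => ψ x - eta x) (deriv ψ x - etaDeriv x) x := fun x =>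
    (hψ1 x).fun_sub (hasDerivAt_eta x)
  have md : MemLp (fun x => ψ x - eta x) 2 := mψ.sub memLp_eta
  have md' : MemLp (fun x => deriv ψ x - etaDeriv x) 2 := mψ'.sub memLp_etaDeriv
  rw [Real.sqrt_lt' hR0, H1sq_eq_of_hasDerivAt hd1] at hdist
  have hD : (∫ x, (ψ x - eta x) ^ 2) ≤
      (∫ x, ((ψ x - eta x) ^ 2 + (deriv ψ x - etaDeriv x) ^ 2)) :=
    integral_mono md.integrable_sq (md.integrable_sq.fun_add md'.integrable_sq)
      fun x => le_add_of_nonneg_right (sq_nonneg _)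
  have hE : (∫ x, eta x ^ 2) ≤ 3 := by
    have := integral_mono memLp_eta.integrable_sq
      ((is.const_mul 2).fun_add (md.integrable_sq.const_mul 2)) fun x => by
            nlinarith [sq_nonneg (2 * ψ x - eta x)]
    rw [integral_add (is.const_mul 2) (md.integrable_sq.const_mul 2), integral_const_mul,
      integral_const_mul] at this
    linarith
  have hH : (∫ x, (eta x ^ 2 + etaDeriv x ^ 2)) ≤ 4 := by
    have := integral_mono (memLp_eta.integrable_sq.fun_add memLp_etaDeriv.integrable_sq)
      (memLp_eta.integrable_sq.const_mul (5 / 4)) fun x => by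
            linarith [etaDeriv_sq_le x]
    rw [integral_const_mul] at this
    linarith
  have hΨ := integral_sq_add_sq_le (h := ψ) (h' := deriv ψ) md md' memLp_eta memLp_etaDeriv
    (fun x => by ring) (fun x => by ring)
  have hψ9 : ∀ x, ψ x ^ 2 ≤ 9 := fun x =>
    (sq_le_integral_sq_add_sq hψ1 mψ mψ' x).trans (by linarith)
  have hτ9 : τ * 9 < 1 := by linarith
  obtain ⟨u, hu, hu', mu, mu', mu'', hequ⟩ :=
    exists_implicit_solution hτ hdψ.continuous mψ hψ9 hτ9
  have huniq : ∀ φ : ℝ → ℝ, Differentiable ℝ φ → Differentiable ℝ (deriv φ) →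
      MemLp φ 2 → MemLp (deriv φ) 2 → MemLp (deriv (deriv φ)) 2 →
      (∀ x, φ x = ψ x + τ * (1 / 2 * deriv (deriv φ) x + ψ x ^ 2 * φ x)) → φ = u :=
    fun φ hφ hφ' mφ mφ' mφ'' heq => eq_of_implicit_solutions hτ hτ9 hψ9 hφ hφ' mφ mφ' mφ''
      hu hu' mu mu' mu'' heq hequ
  have hueven : ∀ x, u (-x) = u x := by
    have e1 : deriv (fun x => u (-x)) = fun x => -deriv u (-x) := funext fun x => deriv_comp_neg u x
    have e2 : deriv (deriv fun x => u (-x)) = fun x => deriv (deriv u) (-x) := by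
      rw [e1]
      funext x
      rw [deriv.fun_neg, deriv_comp_neg, neg_neg]
    have hmp := Measure.measurePreserving_neg (volume : Measure ℝ)
    refine congrFun (huniq (fun x => u (-x)) (hu.comp differentiable_neg) ?_
      (mu.comp_measurePreserving hmp) ?_ ?_ fun x => ?_)
    · rw [e1]
      exact (hu'.comp differentiable_neg).neg
    · rw [e1]
      exact (mu'.comp_measurePreserving hmp).neg
    · rw [e2]
      exact mu''.comp_measurePreserving hmp
    · rw [e2]
      simpa only [heven] using hequ (-x)
  have hw : ∀ x, HasDerivAt (fun x => u x - eta x) (deriv u x - etaDeriv x) x := fun x =>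
    (hu x).hasDerivAt.fun_sub (hasDerivAt_eta x)
  have hw' : ∀ x, HasDerivAt (fun x => deriv u x - etaDeriv x)
      (deriv (deriv u) x - (eta x / 4 - 2 * eta x ^ 3)) x := fun x =>
    (hu' x).hasDerivAt.fun_sub (hasDerivAt_etaDeriv x)
  have mw : MemLp (fun x => u x - eta x) 2 := mu.sub memLp_eta
  have mw' : MemLp (fun x => deriv u x - etaDeriv x) 2 := mu'.sub memLp_etaDeriv
  have henergy := energy_estimate hτ.le hψ9 hw hw' hd1 mw mw' (mu''.sub memLp_deriv_etaDeriv)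
    md md' fun x => by linear_combination hequ x
  have hmassu := abs_mass_sub_le hτ.le hψ9 hψ1 (fun x => (hu x).hasDerivAt)
    (fun x => (hu' x).hasDerivAt) mψ mψ' mu mu' mu'' hequ
  have hU := integral_sq_add_sq_le (h := u) (h' := deriv u) mw mw' memLp_eta memLp_etaDeriv
    (fun x => by ring) (fun x => by ring)
  rw [hmass] at hmassu
  have hnorm := fun N hN => H1sq_normalize_le (N := N) hN hw mw mw'
  simp only [sub_add_cancel] at hnorm
  have hW0 : 0 ≤ ∫ x, ((u x - eta x) ^ 2 + (deriv u x - etaDeriv x) ^ 2) :=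
    integral_nonneg fun x => by positivity
  have hH0 : 0 ≤ ∫ x, (eta x ^ 2 + etaDeriv x ^ 2) := integral_nonneg fun x => by positivity
  set W := ∫ x, ((u x - eta x) ^ 2 + (deriv u x - etaDeriv x) ^ 2)
  set H := ∫ x, (eta x ^ 2 + etaDeriv x ^ 2)
  set m := ∫ x, u x ^ 2
  have hW : W ≤ 51 / 50 * R ^ 2 := by
    nlinarith [mul_le_mul_of_nonneg_right (hτ₀.trans (by linarith : _ ≤ (1 : ℝ) / 1600000)) hW0]
  have hm : |m - 1| ≤ R ^ 2 / 400 := by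
    refine hmassu.trans ?_
    calc _ ≤ τ * 243 := mul_le_mul_of_nonneg_left (by linarith) hτ.le
      _ ≤ _ := by linarith
  obtain ⟨hm1, hm2⟩ := abs_le.1 hm
  have hm0 : 0 < m := by linarith
  have hN : 0 < √m := Real.sqrt_pos.2 hm0
  have hNsq : √m ^ 2 = m := Real.sq_sqrt hm0.le
  refine ⟨u, ⟨hueven, hu, hu', mu.integrable_sq, mu'.integrable_sq, mu''.integrable_sq, hequ⟩,
    fun φ ⟨_, hφ, hφ', iφ, iφ', iφ'', heq⟩ => huniq φ hφ hφ'
      ((memLp_two_iff_integrable_sq hφ.continuous.aestronglyMeasurable).2 iφ)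
      ((memLp_two_iff_integrable_sq hφ'.continuous.aestronglyMeasurable).2 iφ')
      ((memLp_two_iff_integrable_sq (measurable_deriv _).aestronglyMeasurable).2 iφ'') heq,
    hN, ?_, ?_⟩
  · simp only [div_pow]
    rw [integral_div, hNsq]
    exact div_self hm0.ne'
  · rw [Real.sqrt_lt' (by positivity)]
    refine (hnorm _ hN).trans_lt ?_
    have h1 : (1 / √m - 1) ^ 2 ≤ (R ^ 2 / 400) ^ 2 := by
      rw [← sq_abs]
      refine pow_le_pow_left₀ (abs_nonneg _) ?_ 2
      have e : 1 / √m - 1 = (1 - m) / (√m * (1 + √m)) := by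
        field_simp
        linear_combination -hNsq
      have h : 1 ≤ √m * (1 + √m) := by
        have : (1 / 2 : ℝ) ≤ √m := Real.le_sqrt_of_sq_le (by linarith)
        nlinarith
      rw [e, abs_div, abs_sub_comm, abs_of_pos (by positivity : 0 < √m * (1 + √m))]
      exact (div_le_self (abs_nonneg _) h).trans hm
    have h2 : 2 / √m ^ 2 ≤ 201 / 100 := by
      rw [hNsq, div_le_iff₀ hm0]
      linarith
    have h3 : 2 / √m ^ 2 * W ≤ 201 / 100 * (51 / 50 * R ^ 2) :=
      mul_le_mul h2 hW hW0 (by norm_num)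
    have h4 : 2 * (1 / √m - 1) ^ 2 * H ≤ 2 * (R ^ 2 / 400) ^ 2 * 4 :=
      mul_le_mul (by linarith) hH hH0 (by positivity)
    have h5 : 0 < R ^ 2 := by positivity
    nlinarith
end

section
/- Local coordinate recursion for the scheme (Lemma 4.1, equation (4.1)): there exist constants R > 0, τ₀ > 0 and C > 0 such that the following holds for every τ ∈ (0, τ₀]. Let ψ : ℝ → ℝ be even, differentiable, with ψ, ψ' square-integrable, ∫_ℝ ψ² = 1 and ‖ψ − η‖_{H¹} < R; let ψ* be even, three times differentiable with ψ*, ψ*', ψ*'', ψ*''' square-integrable, satisfying ψ* = ψ + τ((1/2)ψ*'' + ψ²ψ*) pointwise and ‖ψ*‖_{L²} > 0; set ψ⁺ = ψ*/‖ψ*‖_{L²}, u = ψ − ⟨ψ,η⟩η and u⁺ = ψ⁺ − ⟨ψ⁺,η⟩η. Then ‖ u⁺ − u − τ·P_W( (1/2)·(u⁺)'' − (1/8)·u + η²·u⁺ + 2·η²·u ) ‖_{H¹} ≤ C·τ·( ‖u‖_{H¹}² + ‖u⁺‖_{H¹}² ), where P_W w = w − ⟨w,η⟩η. -/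
open MeasureTheory

/-- `L²`-orthogonal projection onto the orthogonal complement of `η`:
`P_W w = w − ⟨w,η⟩η`. -/
noncomputable def PW (w : ℝ → ℝ) : ℝ → ℝ := fun x =>
  w x - (∫ y : ℝ, w y * eta y) * eta x

/-- The `L²` norm of a real function on the line. -/
noncomputable def l2norm (f : ℝ → ℝ) : ℝ := Real.sqrt (∫ x : ℝ, (f x)^2)

/-- The `L²` pairing of two real functions on the line. -/
noncomputable def pairing (f g : ℝ → ℝ) : ℝ := ∫ x : ℝ, f x * g x

lemma l2norm_nonneg (f : ℝ → ℝ) : 0 ≤ l2norm f := Real.sqrt_nonneg _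

lemma l2norm_sq (f : ℝ → ℝ) : l2norm f ^ 2 = ∫ x : ℝ, (f x)^2 :=
  Real.sq_sqrt (integral_nonneg fun _ => sq_nonneg _)

lemma pairing_self (f : ℝ → ℝ) : pairing f f = l2norm f ^ 2 := by
  rw [l2norm_sq]
  simp only [pairing, sq]

lemma pairing_comm (f g : ℝ → ℝ) : pairing f g = pairing g f := by
  simp only [pairing, mul_comm]

lemma MeasureTheory.MemLp.integrable_fun_mul {f g : ℝ → ℝ} (hf : MemLp f 2) (hg : MemLp g 2) :
    Integrable (fun x => f x * g x) := hf.integrable_mul hg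

lemma MeasureTheory.MemLp.fun_add {f g : ℝ → ℝ} (hf : MemLp f 2) (hg : MemLp g 2) :
    MemLp (fun x => f x + g x) 2 := hf.add hg

lemma pairing_add_left {f g h : ℝ → ℝ} (hf : MemLp f 2) (hg : MemLp g 2) (hh : MemLp h 2) :
    pairing (fun x => f x + g x) h = pairing f h + pairing g h := by
  unfold pairing
  rw [← integral_add (hf.integrable_fun_mul hh) (hg.integrable_fun_mul hh)]
  simp only [add_mul]

lemma pairing_sub_left {f g h : ℝ → ℝ} (hf : MemLp f 2) (hg : MemLp g 2) (hh : MemLp h 2) :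
    pairing (fun x => f x - g x) h = pairing f h - pairing g h := by
  unfold pairing
  rw [← integral_sub (hf.integrable_fun_mul hh) (hg.integrable_fun_mul hh)]
  simp only [sub_mul]

lemma pairing_const_mul_left (c : ℝ) (f h : ℝ → ℝ) :
    pairing (fun x => c * f x) h = c * pairing f h := by
  unfold pairing
  rw [← integral_const_mul]
  simp only [mul_assoc]

lemma pairing_add_right {f g h : ℝ → ℝ} (hf : MemLp f 2) (hg : MemLp g 2) (hh : MemLp h 2) :
    pairing h (fun x => f x + g x) = pairing h f + pairing h g := by
  rw [pairing_comm, pairing_add_left hf hg hh, pairing_comm f, pairing_comm g]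

/-- Cauchy–Schwarz inequality in `L²(ℝ)`. -/
lemma abs_pairing_le {f g : ℝ → ℝ} (hf : MemLp f 2) (hg : MemLp g 2) :
    |pairing f g| ≤ l2norm f * l2norm g := by
  have key : ∀ t : ℝ, 0 ≤ l2norm f ^ 2 * (t * t) + (2 * pairing f g) * t + l2norm g ^ 2 := by
    intro t
    have h1 : pairing (fun x => t * f x + g x) (fun x => t * f x + g x)
        = l2norm f ^ 2 * (t * t) + (2 * pairing f g) * t + l2norm g ^ 2 := by
      have htf := hf.const_mul t
      rw [pairing_add_left htf hg (htf.fun_add hg), pairing_add_right htf hg htf,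
        pairing_add_right htf hg hg]
      rw [pairing_const_mul_left, pairing_const_mul_left, pairing_comm f, pairing_comm g (fun x => _),
        pairing_const_mul_left, pairing_const_mul_left, pairing_self, pairing_self]
      ring
    rw [← h1, pairing_self]
    positivity
  have := discrim_le_zero key
  rw [discrim] at this
  apply abs_le_of_sq_le_sq _ (mul_nonneg (l2norm_nonneg f) (l2norm_nonneg g))
  nlinarith

lemma l2norm_add_le {f g : ℝ → ℝ} (hf : MemLp f 2) (hg : MemLp g 2) :
    l2norm (fun x => f x + g x) ≤ l2norm f + l2norm g := by
  apply le_of_sq_le_sq _ (add_nonneg (l2norm_nonneg f) (l2norm_nonneg g))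
  rw [← pairing_self, pairing_add_left hf hg (hf.fun_add hg), pairing_add_right hf hg hf,
        pairing_add_right hf hg hg, pairing_comm g f, pairing_self, pairing_self]
  nlinarith [abs_le.1 (abs_pairing_le hf hg)]

lemma l2norm_const_mul (c : ℝ) (f : ℝ → ℝ) : l2norm (fun x => c * f x) = |c| * l2norm f := by
  unfold l2norm
  rw [← Real.sqrt_sq_eq_abs, ← Real.sqrt_mul (sq_nonneg c), ← integral_const_mul]
  simp only [mul_pow]

lemma l2norm_le_of_le {f g : ℝ → ℝ} (hg : MemLp g 2) (h : ∀ x, |f x| ≤ |g x|) :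
    l2norm f ≤ l2norm g :=
  Real.sqrt_le_sqrt <| integral_mono_of_nonneg (.of_forall fun _ => sq_nonneg _) hg.integrable_sq
    (.of_forall fun x => sq_le_sq.2 (h x))

lemma l2norm_le_mul {f g : ℝ → ℝ} {M : ℝ} (hM : 0 ≤ M) (hg : MemLp g 2)
    (h : ∀ x, |f x| ≤ M * |g x|) : l2norm f ≤ M * l2norm g := by
  have := l2norm_le_of_le (f := f) (hg.const_mul M)
    (fun x => by simpa [abs_mul, abs_of_nonneg hM] using h x)
  rwa [l2norm_const_mul, abs_of_nonneg hM] at this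

/-- Membership in `H¹(ℝ)` for everywhere differentiable functions. -/
structure MemH1 (f : ℝ → ℝ) : Prop where
  differentiable : Differentiable ℝ f
  memLp : MemLp f 2
  memLp_deriv : MemLp (deriv f) 2

/-- The `H¹` norm. -/
noncomputable def h1norm (f : ℝ → ℝ) : ℝ := Real.sqrt (H1sq f)

lemma h1norm_nonneg (f : ℝ → ℝ) : 0 ≤ h1norm f := Real.sqrt_nonneg _

lemma H1sq_nonneg (f : ℝ → ℝ) : 0 ≤ H1sq f :=
  integral_nonneg fun _ => add_nonneg (sq_nonneg _) (sq_nonneg _)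

lemma h1norm_sq (f : ℝ → ℝ) : h1norm f ^ 2 = H1sq f := Real.sq_sqrt (H1sq_nonneg f)

namespace MemH1

variable {f g : ℝ → ℝ}

lemma of_integrable (hf : Differentiable ℝ f) (h : Integrable (fun x => (f x)^2))
    (h' : Integrable (fun x => (deriv f x)^2)) : MemH1 f :=
  ⟨hf, (memLp_two_iff_integrable_sq hf.continuous.aestronglyMeasurable).2 h,
    (memLp_two_iff_integrable_sq (aestronglyMeasurable_deriv f _)).2 h'⟩

lemma h1norm_sq_eq (hf : MemH1 f) : h1norm f ^ 2 = l2norm f ^ 2 + l2norm (deriv f) ^ 2 := by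
  rw [h1norm_sq, H1sq, integral_add hf.memLp.integrable_sq hf.memLp_deriv.integrable_sq,
    l2norm_sq, l2norm_sq]

lemma l2norm_le (hf : MemH1 f) : l2norm f ≤ h1norm f := by
  apply le_of_sq_le_sq _ (h1norm_nonneg f)
  nlinarith [hf.h1norm_sq_eq, sq_nonneg (l2norm (deriv f))]

lemma l2norm_deriv_le (hf : MemH1 f) : l2norm (deriv f) ≤ h1norm f := by
  apply le_of_sq_le_sq _ (h1norm_nonneg f)
  nlinarith [hf.h1norm_sq_eq, sq_nonneg (l2norm f)]

lemma deriv_add_eq (hf : MemH1 f) (hg : MemH1 g) :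
    deriv (fun x => f x + g x) = fun x => deriv f x + deriv g x := by
  ext x
  exact deriv_fun_add (hf.differentiable x) (hg.differentiable x)

lemma deriv_mul_eq (hf : MemH1 f) (hg : MemH1 g) :
    deriv (fun x => f x * g x) = fun x => deriv f x * g x + f x * deriv g x := by
  ext x
  exact deriv_fun_mul (hf.differentiable x) (hg.differentiable x)

lemma deriv_const_mul_eq (c : ℝ) (hf : MemH1 f) :
    deriv (fun x => c * f x) = fun x => c * deriv f x := by
  ext x
  exact deriv_const_mul c (hf.differentiable x)

lemma add (hf : MemH1 f) (hg : MemH1 g) : MemH1 (fun x => f x + g x) :=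
  ⟨hf.differentiable.fun_add hg.differentiable, hf.memLp.fun_add hg.memLp, by
    rw [hf.deriv_add_eq hg]; exact hf.memLp_deriv.fun_add hg.memLp_deriv⟩

lemma const_mul (c : ℝ) (hf : MemH1 f) : MemH1 (fun x => c * f x) :=
  ⟨hf.differentiable.const_mul c, hf.memLp.const_mul c, by
    rw [hf.deriv_const_mul_eq c]; exact hf.memLp_deriv.const_mul c⟩

lemma sub (hf : MemH1 f) (hg : MemH1 g) : MemH1 (fun x => f x - g x) := by
  have := hf.add (hg.const_mul (-1))
  simpa [sub_eq_add_neg] using this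

lemma h1norm_add_le (hf : MemH1 f) (hg : MemH1 g) :
    h1norm (fun x => f x + g x) ≤ h1norm f + h1norm g := by
  apply le_of_sq_le_sq _ (add_nonneg (h1norm_nonneg f) (h1norm_nonneg g))
  have h1 := l2norm_add_le hf.memLp hg.memLp
  have h2 := l2norm_add_le hf.memLp_deriv hg.memLp_deriv
  rw [(hf.add hg).h1norm_sq_eq, hf.deriv_add_eq hg]
  have h3 : l2norm f * l2norm g + l2norm (deriv f) * l2norm (deriv g) ≤ h1norm f * h1norm g := by
    apply le_of_sq_le_sq _ (mul_nonneg (h1norm_nonneg f) (h1norm_nonneg g))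
    rw [mul_pow, hf.h1norm_sq_eq, hg.h1norm_sq_eq]
    nlinarith [sq_nonneg (l2norm f * l2norm (deriv g) - l2norm g * l2norm (deriv f))]
  have h4 := pow_le_pow_left₀ (l2norm_nonneg _) h1 2
  have h5 := pow_le_pow_left₀ (l2norm_nonneg _) h2 2
  nlinarith [hf.h1norm_sq_eq, hg.h1norm_sq_eq]

lemma h1norm_const_mul (c : ℝ) (hf : MemH1 f) : h1norm (fun x => c * f x) = |c| * h1norm f := by
  rw [← sq_eq_sq₀ (h1norm_nonneg _) (mul_nonneg (abs_nonneg c) (h1norm_nonneg f)),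
    (hf.const_mul c).h1norm_sq_eq, mul_pow, hf.h1norm_sq_eq, hf.deriv_const_mul_eq c,
    l2norm_const_mul, l2norm_const_mul]
  ring

/-- The Sobolev embedding `H¹(ℝ) ⊆ L^∞(ℝ)` with constant one. -/
lemma abs_le (hf : MemH1 f) (x : ℝ) : |f x| ≤ h1norm f := by
  have hd : ∀ y, HasDerivAt (fun y => f y ^ 2) (2 * (f y * deriv f y)) y := fun y => by
    refine ((hf.differentiable y).hasDerivAt.fun_pow 2).congr_deriv ?_
    push_cast; ring
  have hi : Integrable (fun y => 2 * (f y * deriv f y)) :=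
    (hf.memLp.integrable_fun_mul hf.memLp_deriv).const_mul 2
  have ht := tendsto_zero_of_hasDerivAt_of_integrableOn_Iic (a := x) (fun y _ => hd y)
    hi.integrableOn hf.memLp.integrable_sq.integrableOn
  have h1 := integral_Iic_of_hasDerivAt_of_tendsto' (a := x) (fun y _ => hd y) hi.integrableOn ht
  apply abs_le_of_sq_le_sq _ (h1norm_nonneg f)
  have hi2 : Integrable (fun y => f y ^ 2 + deriv f y ^ 2) :=
    hf.memLp.integrable_sq.add hf.memLp_deriv.integrable_sq
  rw [h1norm_sq, H1sq]
  calc f x ^ 2 = ∫ y in Set.Iic x, 2 * (f y * deriv f y) := by rw [h1]; ring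
    _ ≤ ∫ y in Set.Iic x, (f y ^ 2 + deriv f y ^ 2) :=
        integral_mono hi.integrableOn hi2.integrableOn
          fun y => by nlinarith [sq_nonneg (f y - deriv f y)]
    _ ≤ _ := setIntegral_le_integral hi2
        (.of_forall fun y => add_nonneg (sq_nonneg _) (sq_nonneg _))

lemma memLp_mul (hf : MemH1 f) (hg : MemLp g 2) : MemLp (fun x => f x * g x) 2 :=
  hg.of_le_mul (c := h1norm f) (hf.differentiable.continuous.aestronglyMeasurable.mul hg.1)
    (.of_forall fun x => by
      rw [Real.norm_eq_abs, Real.norm_eq_abs, abs_mul]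
      exact mul_le_mul_of_nonneg_right (hf.abs_le x) (abs_nonneg _))

lemma l2norm_mul_le (hf : MemH1 f) (hg : MemLp g 2) :
    l2norm (fun x => f x * g x) ≤ h1norm f * l2norm g :=
  l2norm_le_mul (h1norm_nonneg f) hg fun x => by
    rw [abs_mul]
    exact mul_le_mul_of_nonneg_right (hf.abs_le x) (abs_nonneg _)

lemma mul (hf : MemH1 f) (hg : MemH1 g) : MemH1 (fun x => f x * g x) :=
  ⟨hf.differentiable.fun_mul hg.differentiable, hf.memLp_mul hg.memLp, by
    rw [hf.deriv_mul_eq hg]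
    refine MemLp.fun_add ?_ (hf.memLp_mul hg.memLp_deriv)
    simpa only [mul_comm] using hg.memLp_mul hf.memLp_deriv⟩

/-- `H¹(ℝ)` is an algebra. -/
lemma h1norm_mul_le (hf : MemH1 f) (hg : MemH1 g) :
    h1norm (fun x => f x * g x) ≤ 3 * (h1norm f * h1norm g) := by
  have hfg := mul_nonneg (h1norm_nonneg f) (h1norm_nonneg g)
  have h1 : l2norm (fun x => f x * g x) ≤ h1norm f * h1norm g :=
    (hf.l2norm_mul_le hg.memLp).trans (mul_le_mul_of_nonneg_left hg.l2norm_le (h1norm_nonneg f))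
  have h2 : l2norm (deriv (fun x => f x * g x)) ≤ 2 * (h1norm f * h1norm g) := by
    rw [hf.deriv_mul_eq hg]
    have e : (fun x => deriv f x * g x) = fun x => g x * deriv f x := by simp only [mul_comm]
    have m : MemLp (fun x => deriv f x * g x) 2 := by rw [e]; exact hg.memLp_mul hf.memLp_deriv
    refine (l2norm_add_le m (hf.memLp_mul hg.memLp_deriv)).trans ?_
    have h3 := hf.l2norm_mul_le hg.memLp_deriv
    have h4 := hg.l2norm_mul_le hf.memLp_deriv
    rw [e]
    nlinarith [hf.l2norm_deriv_le, hg.l2norm_deriv_le, h1norm_nonneg f, h1norm_nonneg g]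
  apply le_of_sq_le_sq _ (by positivity)
  rw [(hf.mul hg).h1norm_sq_eq]
  have h4 := pow_le_pow_left₀ (l2norm_nonneg _) h1 2
  have h5 := pow_le_pow_left₀ (l2norm_nonneg _) h2 2
  nlinarith

/-- Integration by parts on the line. -/
lemma pairing_deriv_left (hf : MemH1 f) (hg : MemH1 g) :
    pairing (deriv f) g = - pairing f (deriv g) := by
  have := integral_mul_deriv_eq_deriv_mul_of_integrable
    (fun x _ => (hf.differentiable x).hasDerivAt) (fun x _ => (hg.differentiable x).hasDerivAt)
    (hf.memLp.integrable_mul hg.memLp_deriv) (hf.memLp_deriv.integrable_mul hg.memLp)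
    (hf.memLp.integrable_mul hg.memLp)
  simp only [pairing, this, neg_neg]

end MemH1

lemma eta_pos (x : ℝ) : 0 < eta x := by
  have := Real.cosh_pos (x/2)
  unfold eta; positivity

lemma eta_le (x : ℝ) : eta x ≤ 1/2 := by
  have := Real.one_le_cosh (x/2)
  unfold eta
  have : 1 / Real.cosh (x/2) ≤ 1 := by rw [div_le_one (by positivity)]; exact this
  linarith

lemma eta_sq_eq (x : ℝ) : eta x ^ 2 = Real.sigmoid x * (1 - Real.sigmoid x) := by
  unfold eta
  rw [Real.sigmoid_def, Real.cosh_eq]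
  have h1 : Real.exp (-x) = Real.exp (-(x/2)) ^ 2 := by rw [← Real.exp_nat_mul]; congr 1; ring
  have h2 : Real.exp (x/2) = (Real.exp (-(x/2)))⁻¹ := by rw [← Real.exp_neg]; simp
  rw [h1, h2]
  have := Real.exp_pos (-(x/2))
  set t := Real.exp (-(x/2))
  field_simp
  ring

lemma hasDerivAt_eta_s11 (x : ℝ) : HasDerivAt eta (-(1/2) * Real.tanh (x/2) * eta x) x := by
  have h1 : HasDerivAt (fun x : ℝ => x/2) (1/2) x := (hasDerivAt_id x).div_const 2
  have h2 := ((h1.cosh).inv (Real.cosh_pos _).ne').const_mul (1/2)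
  have e : eta = fun x => (1/2) * (Real.cosh (x/2))⁻¹ := by ext y; simp [eta]
  rw [e]
  refine h2.congr_deriv ?_
  rw [Real.tanh_eq_sinh_div_cosh]
  have := Real.cosh_pos (x/2)
  field_simp

lemma deriv_eta : deriv eta = fun x => -(1/2) * Real.tanh (x/2) * eta x :=
  funext fun x => (hasDerivAt_eta_s11 x).deriv

lemma hasDerivAt_deriv_eta (x : ℝ) :
    HasDerivAt (deriv eta) ((1/4) * eta x - 2 * eta x ^ 3) x := by
  have h1 : HasDerivAt (fun x : ℝ => x/2) (1/2) x := (hasDerivAt_id x).div_const 2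
  have h2 := ((h1.sinh).div h1.cosh (Real.cosh_pos _).ne').const_mul (-(1/2))
  have h3 := h2.mul (hasDerivAt_eta_s11 x)
  rw [deriv_eta]
  have e : (fun x => -(1/2) * Real.tanh (x/2) * eta x)
    = (fun x : ℝ => -(1/2) * (Real.sinh (x/2) / Real.cosh (x/2))) * eta := by
      ext y; simp [Real.tanh_eq_sinh_div_cosh]
  rw [e]
  refine h3.congr_deriv ?_
  simp only [Pi.div_apply, Real.tanh_eq_sinh_div_cosh, eta]
  have := Real.cosh_pos (x/2)
  have hs := Real.cosh_sq (x/2)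
  field_simp
  linear_combination (-8) * hs

lemma deriv_deriv_eta : deriv (deriv eta) = fun x => (1/4) * eta x - 2 * eta x ^ 3 :=
  funext fun x => (hasDerivAt_deriv_eta x).deriv

lemma differentiable_eta : Differentiable ℝ eta := fun x => (hasDerivAt_eta_s11 x).differentiableAt

lemma hasDerivAt_sigmoid_eta_sq (x : ℝ) : HasDerivAt Real.sigmoid (eta x ^ 2) x := by
  rw [eta_sq_eq]; exact Real.hasDerivAt_sigmoid x

lemma integrable_eta_sq : Integrable (fun x => eta x ^ 2) := by
  have h := integrableOn_Ioi_deriv_of_nonneg' (a := 0) (fun x _ => hasDerivAt_sigmoid_eta_sq x)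
    (fun x _ => sq_nonneg _) Real.tendsto_sigmoid_atTop
  have h' : IntegrableOn (fun x => eta x ^ 2) (Set.Iic 0) := by
    have e : (fun x => eta x ^ 2) = fun x => (fun y => eta y ^ 2) (-x) := by
      ext x; simp [eta, neg_div]
    rw [e, integrableOn_Iic_iff_integrableOn_Iio]
    have := h.comp_neg
    simpa using this
  rw [← integrableOn_univ, ← Set.Iic_union_Ioi (a := (0:ℝ))]
  exact h'.union h

lemma l2norm_eta : l2norm eta = 1 := by
  rw [l2norm, integral_of_hasDerivAt_of_tendsto hasDerivAt_sigmoid_eta_sq integrable_eta_sq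
    Real.tendsto_sigmoid_atBot Real.tendsto_sigmoid_atTop]
  simp

lemma abs_deriv_eta_le (x : ℝ) : |deriv eta x| ≤ (1/2) * |eta x| := by
  rw [deriv_eta, abs_mul, abs_mul]
  have := (Real.abs_tanh_lt_one (x/2)).le
  have h2 : |(-(1/2) : ℝ)| = 1/2 := by norm_num [abs_of_pos]
  rw [h2]
  nlinarith [abs_nonneg (eta x)]

lemma memH1_eta : MemH1 eta :=
  ⟨differentiable_eta, memLp_eta, memLp_eta.of_le_mul (aestronglyMeasurable_deriv _ _)
    (.of_forall abs_deriv_eta_le)⟩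

lemma h1norm_eta_le : h1norm eta ≤ 2 := by
  have h1 := l2norm_le_mul (by norm_num) memLp_eta abs_deriv_eta_le
  rw [l2norm_eta] at h1
  apply le_of_sq_le_sq _ (by norm_num)
  rw [memH1_eta.h1norm_sq_eq, l2norm_eta]
  nlinarith [l2norm_nonneg (deriv eta)]

lemma memH1_deriv_eta : MemH1 (deriv eta) := by
  refine ⟨fun x => (hasDerivAt_deriv_eta x).differentiableAt, memH1_eta.memLp_deriv, ?_⟩
  have := ((memH1_eta.const_mul (1/4)).sub
    ((memH1_eta.mul (memH1_eta.mul memH1_eta)).const_mul 2)).memLp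
  rw [deriv_deriv_eta]
  convert this using 3
  ring

lemma pairing_sub_proj_eta {f : ℝ → ℝ} (hf : MemLp f 2) :
    pairing (fun x => f x - pairing f eta * eta x) eta = 0 := by
  rw [pairing_sub_left hf (memLp_eta.const_mul _) memLp_eta, pairing_const_mul_left, pairing_self,
    l2norm_eta]
  ring

lemma l2norm_sub_const_mul_eta_sq {f : ℝ → ℝ} (hf : MemLp f 2) (c : ℝ) :
    l2norm (fun x => f x - c * eta x) ^ 2 = l2norm f ^ 2 - 2 * c * pairing f eta + c ^ 2 := by
  have hc := memLp_eta.const_mul c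
  have hs : MemLp (fun x => f x - c * eta x) 2 := hf.sub hc
  rw [← pairing_self, pairing_sub_left hf hc hs, pairing_comm f, pairing_comm (fun x => c * eta x),
    pairing_sub_left hf hc hf, pairing_sub_left hf hc hc, pairing_const_mul_left,
    pairing_comm f (fun x => c * eta x), pairing_const_mul_left, pairing_const_mul_left,
    pairing_comm eta (fun x => c * eta x), pairing_const_mul_left, pairing_self, pairing_self,
    l2norm_eta, pairing_comm eta f]
  ring

lemma pairing_linear_combination {f₁ f₂ f₃ f₄ g : ℝ → ℝ} (c₁ c₂ c₃ c₄ : ℝ) (h₁ : MemLp f₁ 2)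
    (h₂ : MemLp f₂ 2) (h₃ : MemLp f₃ 2) (h₄ : MemLp f₄ 2) (hg : MemLp g 2) :
    pairing (fun x => c₁ * f₁ x + (c₂ * f₂ x + (c₃ * f₃ x + c₄ * f₄ x))) g =
      c₁ * pairing f₁ g + (c₂ * pairing f₂ g + (c₃ * pairing f₃ g + c₄ * pairing f₄ g)) := by
  have k₁ := h₁.const_mul c₁
  have k₂ := h₂.const_mul c₂
  have k₃ := h₃.const_mul c₃
  have k₄ := h₄.const_mul c₄
  rw [pairing_add_left k₁ (k₂.fun_add (k₃.fun_add k₄)) hg,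
    pairing_add_left k₂ (k₃.fun_add k₄) hg, pairing_add_left k₃ k₄ hg]
  simp only [pairing_const_mul_left]

lemma MemH1.h1norm_eta_mul_le {f : ℝ → ℝ} (hf : MemH1 f) :
    h1norm (fun x => eta x * f x) ≤ 6 * h1norm f := by
  refine (memH1_eta.h1norm_mul_le hf).trans ?_
  nlinarith [h1norm_eta_le, h1norm_nonneg f]

lemma MemH1.h1norm_add_const_mul_le {f g : ℝ → ℝ} {M K : ℝ} (c : ℝ) (hf : MemH1 f) (hg : MemH1 g)
    (hM : h1norm f ≤ M) (hK : h1norm g ≤ K) :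
    h1norm (fun x => c * f x + g x) ≤ |c| * M + K := by
  refine ((hf.const_mul c).h1norm_add_le hg).trans ?_
  rw [hf.h1norm_const_mul]
  gcongr

/-- The terms of degree at least two of `(aη + u)²(bη + v)`. -/
noncomputable def remainder (a b : ℝ) (u v : ℝ → ℝ) (x : ℝ) : ℝ :=
  ((a ^ 2 - 1) * b) * (eta x * (eta x * eta x)) + ((a ^ 2 - 1) * (eta x * (eta x * v x)) +
    ((2 * (a * b - 1)) * (eta x * (eta x * u x)) + ((2 * a) * (eta x * (u x * v x)) +
      (b * (eta x * (u x * u x)) + u x * (u x * v x)))))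

lemma memH1_remainder (a b : ℝ) {u v : ℝ → ℝ} (hu : MemH1 u) (hv : MemH1 v) :
    MemH1 (remainder a b u v) := by
  have hη := memH1_eta
  exact ((hη.mul (hη.mul hη)).const_mul _).add <| ((hη.mul (hη.mul hv)).const_mul _).add <|
    ((hη.mul (hη.mul hu)).const_mul _).add <| ((hη.mul (hu.mul hv)).const_mul _).add <|
    ((hη.mul (hu.mul hu)).const_mul _).add <| hu.mul (hu.mul hv)

lemma h1norm_remainder_le (a b : ℝ) {u v : ℝ → ℝ} (hu : MemH1 u) (hv : MemH1 v) :
    h1norm (remainder a b u v) ≤ |(a ^ 2 - 1) * b| * 72 + (|a ^ 2 - 1| * (36 * h1norm v) +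
      (|2 * (a * b - 1)| * (36 * h1norm u) + (|2 * a| * (18 * (h1norm u * h1norm v)) +
        (|b| * (18 * (h1norm u * h1norm u)) + 9 * (h1norm u * (h1norm u * h1norm v)))))) := by
  have hη := memH1_eta
  have huv := hu.mul hv
  have huu := hu.mul hu
  have m₆ := hu.mul huv
  have m₅ := ((hη.mul huu).const_mul b).add m₆
  have m₄ := ((hη.mul huv).const_mul (2 * a)).add m₅
  have m₃ := ((hη.mul (hη.mul hu)).const_mul (2 * (a * b - 1))).add m₄
  have m₂ := ((hη.mul (hη.mul hv)).const_mul (a ^ 2 - 1)).add m₃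
  have bη : ∀ {f : ℝ → ℝ}, MemH1 f → ∀ {M : ℝ}, h1norm f ≤ M →
      h1norm (fun x => eta x * f x) ≤ 6 * M := fun hf _ h =>
    hf.h1norm_eta_mul_le.trans (by linarith)
  refine MemH1.h1norm_add_const_mul_le _ (hη.mul (hη.mul hη)) m₂ ?_ <|
    MemH1.h1norm_add_const_mul_le _ (hη.mul (hη.mul hv)) m₃ ?_ <|
    MemH1.h1norm_add_const_mul_le _ (hη.mul (hη.mul hu)) m₄ ?_ <|
    MemH1.h1norm_add_const_mul_le _ (hη.mul huv) m₅ ?_ <|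
    MemH1.h1norm_add_const_mul_le _ (hη.mul huu) m₆ ?_ ?_
  · linarith [bη (hη.mul hη) (bη hη h1norm_eta_le)]
  · linarith [bη (hη.mul hv) (bη hv le_rfl)]
  · linarith [bη (hη.mul hu) (bη hu le_rfl)]
  · linarith [bη huv (hu.h1norm_mul_le hv)]
  · linarith [bη huu (hu.h1norm_mul_le hu)]
  · have := hu.h1norm_mul_le huv
    nlinarith [hu.h1norm_mul_le hv, h1norm_nonneg u]

lemma scalar_remainder_le {a b x y g : ℝ} (hx : 0 ≤ x) (hx' : x ≤ 1/16) (hy : 0 ≤ y)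
    (ha : 0 < a) (ha' : a ≤ 1) (hb : 0 < b) (hb' : b ≤ 1) (hax : 1 - a ^ 2 ≤ x ^ 2)
    (hby : 1 - b ^ 2 ≤ y ^ 2)
    (hg : g ≤ |(a ^ 2 - 1) * b| * 72 + (|a ^ 2 - 1| * (36 * y) +
      (|2 * (a * b - 1)| * (36 * x) + (|2 * a| * (18 * (x * y)) +
        (|b| * (18 * (x * x)) + 9 * (x * (x * y))))))) :
    g ≤ 120 * (x ^ 2 + y ^ 2) := by
  have h2 : |a ^ 2 - 1| ≤ x ^ 2 := by rw [abs_le]; constructor <;> nlinarith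
  have h1 : |(a ^ 2 - 1) * b| ≤ x ^ 2 := by
    rw [abs_mul, abs_of_pos hb]; nlinarith [abs_nonneg (a ^ 2 - 1)]
  have h3 : |2 * (a * b - 1)| ≤ 2 * (x ^ 2 + y ^ 2) := by
    rw [abs_le]; constructor <;> nlinarith
  have h4 : |2 * a| ≤ 2 := by rw [abs_of_pos (by linarith)]; linarith
  have h5 : |b| ≤ 1 := by rw [abs_of_pos hb]; exact hb'
  have hxy : 2 * (x * y) ≤ x ^ 2 + y ^ 2 := by nlinarith [sq_nonneg (x - y)]
  have hxy0 := mul_nonneg hx hy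
  have hxxy : x * (x * y) ≤ (1/16) * (x * y) := by nlinarith
  have hsx : (x ^ 2 + y ^ 2) * x ≤ (x ^ 2 + y ^ 2) * (1/16) := by gcongr
  have e2 : |a ^ 2 - 1| * (36 * y) ≤ x ^ 2 * (36 * y) := by gcongr
  have e3 : |2 * (a * b - 1)| * (36 * x) ≤ 2 * (x ^ 2 + y ^ 2) * (36 * x) := by gcongr
  have e4 : |2 * a| * (18 * (x * y)) ≤ 2 * (18 * (x * y)) := by gcongr
  have e5 : |b| * (18 * (x * x)) ≤ 1 * (18 * (x * x)) := by gcongr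
  nlinarith

set_option maxHeartbeats 400000 in
lemma scalar_main_le {a b x y g τ κ E U W P Q S : ℝ} (hτ : 0 < τ) (hτ' : τ ≤ 1/100)
    (hx : 0 ≤ x) (hx' : x ≤ 1/16) (hy : 0 ≤ y) (ha : 99/100 ≤ a) (hb : 0 < b)
    (hg : g ≤ 120 * (x ^ 2 + y ^ 2)) (hE : |E| ≤ 2 * x)
    (hbE : b = κ * a + τ * (b / 8 + E)) (hU0 : 0 ≤ U) (hU : U ≤ x) (hW0 : 0 ≤ W) (hW : W ≤ x + y)
    (hW2 : W ≤ 2) (hab : a ^ 2 - b ^ 2 = (κ - 1) * S + τ * (1/2 * P + Q)) (hS : |S| ≤ U * W)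
    (hP : |P| ≤ y * (x + y)) (hQ : |Q| ≤ (g + 36 * y + 72 * x) * W) :
    |κ - 1 + τ / 8| * x + 3 * τ * g ≤ 500 * τ * (x ^ 2 + y ^ 2) := by
  set s := x ^ 2 + y ^ 2 with hs
  have hs0 : 0 ≤ s := by positivity
  have hxy : 2 * (x * y) ≤ s := by nlinarith [sq_nonneg (x - y)]
  have hα : |κ - 1 + τ / 8| ≤ 2 * |b - a| + 4 * τ * x := by
    have e : (κ - 1 + τ / 8) * a = (b - a) * (1 - τ / 8) - τ * E := by linarith
    have h1 : |κ - 1 + τ / 8| * a ≤ |b - a| + τ * (2 * x) := by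
      calc |κ - 1 + τ / 8| * a = |(b - a) * (1 - τ / 8) - τ * E| := by
            rw [← e, abs_mul, abs_of_pos (by linarith : 0 < a)]
        _ ≤ |(b - a) * (1 - τ / 8)| + |τ * E| := abs_sub _ _
        _ = |b - a| * (1 - τ / 8) + τ * |E| := by
            rw [abs_mul, abs_mul, abs_of_pos hτ, abs_of_pos (by linarith : 0 < 1 - τ / 8)]
        _ ≤ |b - a| + τ * (2 * x) := by
            have := mul_nonneg (abs_nonneg (b - a)) hτ.le
            nlinarith
    nlinarith [abs_nonneg (κ - 1 + τ / 8)]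
  have hκ : |κ - 1| ≤ 2 * |b - a| + 2 * τ := by
    have : |κ - 1| ≤ |κ - 1 + τ / 8| + τ / 8 := by
      have := abs_sub (κ - 1 + τ / 8) (τ / 8)
      rwa [add_sub_cancel_right, abs_of_pos (by linarith : 0 < τ / 8)] at this
    nlinarith
  have hQ' : |Q| ≤ 384 * s := by
    refine hQ.trans ?_
    have h1 : g * W ≤ 120 * s * 2 :=
      (mul_le_mul_of_nonneg_right hg hW0).trans (mul_le_mul_of_nonneg_left hW2 (by positivity))
    have h2 : (36 * y + 72 * x) * W ≤ (36 * y + 72 * x) * (x + y) := by gcongr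
    nlinarith
  have hδ : |b - a| ≤ 700 * (τ * s) := by
    have h0 : |b - a| * (99/100) ≤ |a ^ 2 - b ^ 2| := by
      rw [show a ^ 2 - b ^ 2 = (a - b) * (a + b) by ring, abs_mul, abs_sub_comm b a,
        abs_of_pos (by linarith : 0 < a + b)]
      gcongr
      linarith
    have h1 : |a ^ 2 - b ^ 2| ≤ |κ - 1| * (U * W) + τ * (1/2 * (y * (x + y)) + 384 * s) := by
      rw [hab]
      refine (abs_add_le _ _).trans ?_
      rw [abs_mul, abs_mul, abs_of_pos hτ]
      have h2 : |1/2 * P + Q| ≤ 1/2 * |P| + |Q| := by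
        refine (abs_add_le _ _).trans ?_
        rw [abs_mul, abs_of_pos (by norm_num : (0:ℝ) < 1/2)]
      gcongr
      linarith
    have h3 : U * W ≤ 1/8 := by nlinarith
    have h4 : U * W ≤ x * (x + y) := mul_le_mul hU hW hW0 hx
    have h5 : |κ - 1| * (U * W) ≤ (2 * |b - a| + 2 * τ) * (U * W) := by gcongr
    have h6 : |b - a| * (U * W) ≤ |b - a| * (1/8) := by gcongr
    have h7 : τ * (U * W) ≤ τ * (2 * s) :=
      mul_le_mul_of_nonneg_left (by linarith [sq_nonneg x, sq_nonneg y]) hτ.le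
    have h8 : τ * (1/2 * (y * (x + y)) + 384 * s) ≤ τ * (386 * s) :=
      mul_le_mul_of_nonneg_left (by linarith [sq_nonneg x, sq_nonneg y]) hτ.le
    have h9 : 0 ≤ τ * s := by positivity
    have h10 : |κ - 1| * (U * W) ≤ 2 * (|b - a| * (U * W)) + 2 * (τ * (U * W)) :=
      h5.trans_eq (by ring)
    linarith only [h0, h1, h6, h7, h8, h9, h10]
  have hτs : 0 ≤ τ * s := by positivity
  have h1 : |κ - 1 + τ / 8| * x ≤ (2 * (700 * (τ * s)) + 4 * τ * x) * x := by
    gcongr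
    linarith
  have h2 : (τ * s) * x ≤ (τ * s) * (1/16) := by gcongr
  have h3 : τ * x ^ 2 ≤ τ * s := by
    gcongr
    nlinarith
  have h4 : τ * g ≤ τ * (120 * s) := by gcongr
  nlinarith

lemma l2norm_sq_sub_eta_mul_le {ψ : ℝ → ℝ} (hψ : MemH1 ψ)
    (h : h1norm (fun x => ψ x - eta x) ≤ 1/100) :
    l2norm (fun x => ψ x * (ψ x * eta x) - eta x * (eta x * eta x)) ≤
      l2norm (fun x => ψ x - eta x) := by
  have hd := hψ.sub memH1_eta
  refine l2norm_le_of_le hd.memLp fun x => ?_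
  have h1 := (hd.abs_le x).trans h
  have h2 := eta_pos x
  have h3 := eta_le x
  rw [show ψ x * (ψ x * eta x) - eta x * (eta x * eta x)
    = (ψ x - eta x) * ((ψ x - eta x + 2 * eta x) * eta x) by ring, abs_mul]
  refine mul_le_of_le_one_right (abs_nonneg _) ?_
  rw [abs_mul, abs_of_pos h2]
  have h4 : |ψ x - eta x + 2 * eta x| ≤ 2 :=
    (abs_add_le _ _).trans (by rw [abs_of_pos (by linarith : 0 < 2 * eta x)]; linarith)
  nlinarith [abs_nonneg (ψ x - eta x + 2 * eta x)]

set_option maxHeartbeats 400000 in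
/-- The estimate of the local recursion, for the normalized step written as
`p = κψ + τ(p''/2 + ψ²p)`. -/
theorem normalized_step_h1norm_le {τ κ : ℝ} (hτ : 0 < τ) (hτ' : τ ≤ 1/100) (hκ : 0 < κ)
    {ψ p : ℝ → ℝ} (hψ : MemH1 ψ) (hp : MemH1 p) (hp' : MemH1 (deriv p)) (nψ : l2norm ψ = 1)
    (np : l2norm p = 1) (hR : h1norm (fun x => ψ x - eta x) ≤ 1/100)
    (eqn : ∀ x, p x = κ * ψ x + τ * ((1/2) * deriv (deriv p) x + (ψ x)^2 * p x))
    {u v : ℝ → ℝ} (hu : u = fun x => ψ x - pairing ψ eta * eta x)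
    (hv : v = fun x => p x - pairing p eta * eta x) :
    h1norm (fun x => v x - u x - τ * PW (fun y => (1/2) * deriv (deriv v) y - (1/8) * u y +
      (eta y)^2 * v y + 2 * (eta y)^2 * u y) x) ≤ 500 * τ * (h1norm u ^ 2 + h1norm v ^ 2) := by
  have hη := memH1_eta
  have hp2 := hp'.memLp_deriv
  obtain ⟨a, ha⟩ : ∃ a, a = pairing ψ eta := ⟨_, rfl⟩
  obtain ⟨b, hb⟩ : ∃ b, b = pairing p eta := ⟨_, rfl⟩
  rw [← ha] at hu
  rw [← hb] at hv
  have mu : MemH1 u := hu ▸ hψ.sub (hη.const_mul a)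
  have mv : MemH1 v := hv ▸ hp.sub (hη.const_mul b)
  have uη : pairing u eta = 0 := by rw [hu, ha]; exact pairing_sub_proj_eta hψ.memLp
  have vη : pairing v eta = 0 := by rw [hv, hb]; exact pairing_sub_proj_eta hp.memLp
  have Usq : l2norm u ^ 2 = 1 - a ^ 2 := by
    rw [hu, l2norm_sub_const_mul_eta_sq hψ.memLp, nψ, ← ha]; ring
  have Vsq : l2norm v ^ 2 = 1 - b ^ 2 := by
    rw [hv, l2norm_sub_const_mul_eta_sq hp.memLp, np, ← hb]; ring
  have dv : deriv v = fun x => deriv p x - b * deriv eta x := by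
    ext x
    rw [hv]
    exact (((hp.differentiable x).hasDerivAt.sub
      ((hη.differentiable x).hasDerivAt.const_mul b))).deriv
  have ddv : deriv (deriv v) = fun x => deriv (deriv p) x - b * deriv (deriv eta) x := by
    ext x
    rw [dv]
    exact (((hp'.differentiable x).hasDerivAt.sub
      ((memH1_deriv_eta.differentiable x).hasDerivAt.const_mul b))).deriv
  have mv' : MemH1 (deriv v) := dv ▸ hp'.sub (memH1_deriv_eta.const_mul b)
  -- closeness to the ground state
  set x := h1norm u with hx
  set y := h1norm v with hy
  have x0 : 0 ≤ x := h1norm_nonneg u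
  have y0 : 0 ≤ y := h1norm_nonneg v
  have Ux : l2norm u ≤ x := mu.l2norm_le
  have Vy : l2norm v ≤ y := mv.l2norm_le
  have U0 := l2norm_nonneg u
  have V0 := l2norm_nonneg v
  have md := hψ.sub hη
  set r := l2norm (fun x => ψ x - eta x) with hr
  have r0 : 0 ≤ r := l2norm_nonneg _
  have rR : r ≤ 1/100 := md.l2norm_le.trans hR
  have rsq : r ^ 2 = 2 - 2 * a := by
    have := l2norm_sub_const_mul_eta_sq hψ.memLp 1
    simp only [one_mul] at this
    rw [hr, this, nψ, ← ha]; ring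
  have a_le : a ≤ 1 := by linarith only [rsq, sq_nonneg r]
  have a_ge : 9999/10000 ≤ a := by nlinarith only [rsq, r0, rR]
  have x_le : x ≤ 1/16 := by
    have e : u = fun x => (1 - a) * eta x + (ψ x - eta x) := by rw [hu]; ext; ring
    have := MemH1.h1norm_add_const_mul_le (1 - a) hη md h1norm_eta_le hR
    rw [← e, abs_of_nonneg (by linarith)] at this
    linarith
  have r_le : r ≤ 2 * x := by
    have e : (fun x => ψ x - eta x) = fun x => u x + (a - 1) * eta x := by rw [hu]; ext; ring
    have := l2norm_add_le mu.memLp (memLp_eta.const_mul (a - 1))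
    rw [← e, l2norm_const_mul, l2norm_eta, abs_of_nonpos (by linarith)] at this
    nlinarith only [this, Usq, U0, Ux, x_le, a_ge, a_le]
  -- the normalization constant is close to one
  have mψψp : MemLp (fun x => ψ x * (ψ x * p x)) 2 := hψ.memLp_mul (hψ.mul hp).memLp
  have eqn' : p = fun x => κ * ψ x + (τ / 2 * deriv (deriv p) x +
      (τ * (ψ x * (ψ x * p x)) + 0 * p x)) := by
    ext x
    linear_combination eqn x
  have pair_p : ∀ g : ℝ → ℝ, MemLp g 2 → pairing p g = κ * pairing ψ g +
      (τ / 2 * pairing (deriv (deriv p)) g + τ * pairing (fun x => ψ x * (ψ x * p x)) g) := by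
    intro g hg
    conv_lhs => rw [eqn']
    rw [pairing_linear_combination _ _ _ _ hψ.memLp hp2 mψψp hp.memLp hg]
    ring
  have hψ1 : ∀ x, |ψ x| ≤ 1 := fun x => by
    have h1 := (md.abs_le x).trans hR
    have h2 := abs_add_le (ψ x - eta x) (eta x)
    rw [sub_add_cancel, abs_of_pos (eta_pos x)] at h2
    linarith [eta_le x]
  have κ_ge : 1 - τ ≤ κ := by
    have h := pair_p p hp.memLp
    have h1 := abs_pairing_le hψ.memLp hp.memLp
    have h2 := abs_pairing_le mψψp hp.memLp
    have h3 : l2norm (fun x => ψ x * (ψ x * p x)) ≤ l2norm p :=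
      l2norm_le_of_le hp.memLp fun x => by
        rw [abs_mul, abs_mul]
        have := hψ1 x
        have q := abs_nonneg (ψ x)
        have := mul_le_one₀ this q this
        nlinarith only [this, abs_nonneg (p x)]
    rw [pairing_self, hp'.pairing_deriv_left hp, pairing_self, np] at h
    rw [nψ, np] at h1
    rw [np] at h2 h3
    have h4 := (abs_le.1 h1).2
    have h5 := (le_abs_self _).trans (h2.trans (by linarith : _ ≤ (1:ℝ)))
    have h6 := mul_le_mul_of_nonneg_left h4 hκ.le
    have h7 := mul_le_mul_of_nonneg_left h5 hτ.le
    have h8 := mul_nonneg hτ.le (sq_nonneg (l2norm (deriv p)))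
    linarith only [h, h6, h7, h8]
  -- the component along the ground state
  have mη3 : MemLp (fun x => eta x * (eta x * eta x)) 2 := (hη.mul (hη.mul hη)).memLp
  obtain ⟨E, hE⟩ : ∃ E, E = pairing (fun x => ψ x * (ψ x * eta x) - eta x * (eta x * eta x)) p :=
    ⟨_, rfl⟩
  have E_le : |E| ≤ r := by
    rw [hE]
    refine (abs_pairing_le ((hψ.mul (hψ.mul hη)).sub (hη.mul (hη.mul hη))).memLp hp.memLp).trans ?_
    rw [np, mul_one]
    exact l2norm_sq_sub_eta_mul_le hψ hR
  have hbE : b = κ * a + τ * (b / 8 + E) := by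
    have h := pair_p eta memLp_eta
    have h1 : pairing (deriv (deriv p)) eta =
        1/4 * b - 2 * pairing (fun x => eta x * (eta x * eta x)) p := by
      rw [hp'.pairing_deriv_left hη, hp.pairing_deriv_left memH1_deriv_eta, neg_neg, pairing_comm,
        hb, pairing_comm p eta, ← pairing_const_mul_left, ← pairing_const_mul_left,
        ← pairing_sub_left (memLp_eta.const_mul _) (mη3.const_mul _) hp.memLp, deriv_deriv_eta]
      congr 1
      ext x
      ring
    have h2 : pairing (fun x => ψ x * (ψ x * p x)) eta
        = E + pairing (fun x => eta x * (eta x * eta x)) p := by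
      rw [hE, pairing_sub_left (hψ.mul (hψ.mul hη)).memLp mη3 hp.memLp, sub_add_cancel]
      unfold pairing
      congr 1
      ext x
      ring
    rw [h1, h2, ← ha, ← hb] at h
    linarith
  have hE_abs := abs_le.1 E_le
  have b_pos : 0 < b := by
    have h1 : (1 - τ) * a ≤ κ * a := by gcongr
    have h2 : (99/100 : ℝ) * (99/100) ≤ (1 - τ) * a :=
      mul_le_mul (by linarith only [hτ']) (by linarith only [a_ge]) (by norm_num)
        (by linarith only [hτ'])
    have h3 : τ * (-(1/100)) ≤ τ * E :=
      mul_le_mul_of_nonneg_left (by linarith only [hE_abs.1, rR]) hτ.le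
    have h4 : 0 < b * (1 - τ / 8) := by linarith only [h1, h2, h3, hbE, hτ']
    exact pos_of_mul_pos_left h4 (by linarith only [hτ'])
  have b_le : b ≤ 1 :=
    le_of_sq_le_sq (by linarith only [sq_nonneg (l2norm v), Vsq]) zero_le_one
  -- the equation for `v`
  have mG := memH1_remainder a b mu mv
  set G := remainder a b u v with hG
  have g_le : h1norm G ≤ 120 * (x ^ 2 + y ^ 2) :=
    scalar_remainder_le x0 x_le y0 (by linarith) a_le b_pos b_le
      (Usq ▸ pow_le_pow_left₀ U0 Ux 2) (Vsq ▸ pow_le_pow_left₀ V0 Vy 2)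
      (h1norm_remainder_le a b mu mv)
  set L : ℝ → ℝ := fun x => 1 * (eta x * (eta x * v x)) + 2 * (eta x * (eta x * u x)) with hL
  have mηv := hη.mul (hη.mul mv)
  have mηu := hη.mul (hη.mul mu)
  have mL : MemH1 L := (mηv.const_mul 1).add (mηu.const_mul 2)
  have L_le : h1norm L ≤ 36 * y + 72 * x := by
    have h1 := mηv.h1norm_add_const_mul_le 1 (mηu.const_mul 2) le_rfl le_rfl
    rw [mηu.h1norm_const_mul] at h1
    have h2 := (hη.mul mv).h1norm_eta_mul_le
    have h3 := (hη.mul mu).h1norm_eta_mul_le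
    have h4 := mv.h1norm_eta_mul_le
    have h5 := mu.h1norm_eta_mul_le
    norm_num at h1
    simp only [hL, one_mul]
    linarith
  have veq : ∀ x, v x = κ * u x + (τ / 2 * deriv (deriv v) x +
      (τ * (G x + L x) + (-(τ * E)) * eta x)) := by
    intro x
    have h1 : v x = p x - b * eta x := by rw [hv]
    have h2 : u x = ψ x - a * eta x := by rw [hu]
    have h3 : deriv (deriv v) x = deriv (deriv p) x - b * (1/4 * eta x - 2 * eta x ^ 3) := by
      rw [ddv, deriv_deriv_eta]
    have h4 : G x + L x = ψ x ^ 2 * p x - b * eta x ^ 3 := by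
      simp only [hG, hL, remainder, h1, h2]
      ring
    rw [h4, h3, h2, h1]
    linear_combination eqn x - eta x * hbE
  have mGL := mG.add mL
  have pair_v : ∀ g : ℝ → ℝ, MemLp g 2 → pairing v g = κ * pairing u g +
      (τ / 2 * pairing (deriv (deriv v)) g + (τ * pairing (fun x => G x + L x) g
        + (-(τ * E)) * pairing eta g)) := by
    intro g hg
    conv_lhs => rw [funext veq]
    exact pairing_linear_combination _ _ _ _ mu.memLp mv'.memLp_deriv mGL.memLp memLp_eta hg
  -- the difference of the components along the ground state
  have mw := mu.add mv
  have U1 : l2norm u ≤ 1 :=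
    le_of_sq_le_sq (by linarith only [sq_nonneg a, Usq]) zero_le_one
  have V1 : l2norm v ≤ 1 :=
    le_of_sq_le_sq (by linarith only [sq_nonneg b, Vsq]) zero_le_one
  set w : ℝ → ℝ := fun x => u x + v x with hw
  have W_le : l2norm w ≤ l2norm u + l2norm v := l2norm_add_le mu.memLp mv.memLp
  have hab : a ^ 2 - b ^ 2 = (κ - 1) * pairing u w +
      τ * (1/2 * pairing (deriv (deriv v)) w + pairing (fun x => G x + L x) w) := by
    have h1 := pair_v w mw.memLp
    have h2 : pairing eta w = 0 := by
      rw [pairing_comm, hw, pairing_add_left mu.memLp mv.memLp memLp_eta, uη, vη, add_zero]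
    have h3 : pairing v w - pairing u w = l2norm v ^ 2 - l2norm u ^ 2 := by
      rw [hw, pairing_add_right mu.memLp mv.memLp mv.memLp,
        pairing_add_right mu.memLp mv.memLp mu.memLp, pairing_comm v u, pairing_self, pairing_self]
      ring
    rw [h2] at h1
    linarith
  have hP : |pairing (deriv (deriv v)) w| ≤ y * (x + y) := by
    rw [mv'.pairing_deriv_left mw, abs_neg]
    refine (abs_pairing_le mv'.memLp mw.memLp_deriv).trans ?_
    exact mul_le_mul mv.l2norm_deriv_le (mw.l2norm_deriv_le.trans (mu.h1norm_add_le mv))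
      (l2norm_nonneg _) y0
  have hQ : |pairing (fun x => G x + L x) w| ≤ (h1norm G + 36 * y + 72 * x) * l2norm w := by
    refine (abs_pairing_le mGL.memLp mw.memLp).trans ?_
    refine mul_le_mul_of_nonneg_right ?_ (l2norm_nonneg _)
    linarith [mGL.l2norm_le, mG.h1norm_add_le mL]
  have main := scalar_main_le hτ hτ' x0 x_le y0 (by linarith) b_pos g_le (E_le.trans r_le) hbE U0 Ux
    (l2norm_nonneg w) (by linarith only [W_le, Ux, Vy]) (by linarith only [W_le, U1, V1]) hab (abs_pairing_le mu.memLp mw.memLp) hP hQ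
  -- the defect
  have hJ : pairing (fun y => (1/2) * deriv (deriv v) y - (1/8) * u y + (eta y)^2 * v y +
      2 * (eta y)^2 * u y) eta = E - pairing G eta := by
    have h1 := pair_v eta memLp_eta
    rw [uη, vη, pairing_self, l2norm_eta, pairing_add_left mG.memLp mL.memLp memLp_eta] at h1
    have h2 := pairing_linear_combination (1/2) (-(1/8)) 1 0 mv'.memLp_deriv mu.memLp mL.memLp
      mu.memLp memLp_eta
    have h3 : (fun y => (1/2) * deriv (deriv v) y - (1/8) * u y + (eta y)^2 * v y +
      2 * (eta y)^2 * u y) = fun x => 1/2 * deriv (deriv v) x + (-(1/8) * u x +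
        (1 * L x + 0 * u x)) := by
      ext x
      simp only [hL]
      ring
    rw [h3, h2, uη]
    have h4 : τ * (1/2 * pairing (deriv (deriv v)) eta + pairing G eta + pairing L eta - E) = 0 := by
      linarith
    have h5 := (mul_eq_zero.1 h4).resolve_left hτ.ne'
    linarith
  have hD : (fun x => v x - u x - τ * PW (fun y => (1/2) * deriv (deriv v) y - (1/8) * u y +
      (eta y)^2 * v y + 2 * (eta y)^2 * u y) x) =
      fun x => (κ - 1 + τ / 8) * u x + (τ * G x + (-(τ * pairing G eta)) * eta x) := by
    ext x
    have h1 : ∀ f : ℝ → ℝ, PW f x = f x - pairing f eta * eta x := fun f => rfl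
    rw [h1, hJ]
    have h2 := veq x
    have h3 : L x = eta x ^ 2 * v x + 2 * eta x ^ 2 * u x := by
      simp only [hL]
      ring
    rw [h3] at h2
    linear_combination h2
  rw [hD]
  have hGη : |-(τ * pairing G eta)| ≤ τ * h1norm G := by
    rw [abs_neg, abs_mul, abs_of_pos hτ]
    have := abs_pairing_le mG.memLp memLp_eta
    rw [l2norm_eta, mul_one] at this
    exact mul_le_mul_of_nonneg_left (this.trans mG.l2norm_le) hτ.le
  have h1 : h1norm (fun x => (-(τ * pairing G eta)) * eta x) ≤ τ * h1norm G * 2 := by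
    rw [hη.h1norm_const_mul]
    exact mul_le_mul hGη h1norm_eta_le (h1norm_nonneg _) (mul_nonneg hτ.le (h1norm_nonneg _))
  have h2 := MemH1.h1norm_add_const_mul_le τ mG (hη.const_mul (-(τ * pairing G eta))) le_rfl h1
  have h3 := MemH1.h1norm_add_const_mul_le (κ - 1 + τ / 8) mu
    ((mG.const_mul τ).add (hη.const_mul (-(τ * pairing G eta)))) le_rfl h2
  rw [abs_of_pos hτ] at h3
  linarith

/-- local coordinate recursion for the scheme (Lemma 4.1, equation (4.1)):
for the linearly implicit normalized step `ψ ↦ ψ⁺ = ψ*/‖ψ*‖_{L²}`, written in the coordinates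
`u = P_W ψ`, `u⁺ = P_W ψ⁺` orthogonal to `η`, one has
`u⁺ = u + τ P_W((1/2)(u⁺)'' − (1/8)u + η²u⁺ + 2η²u) + O(τ(‖u‖_{H¹}² + ‖u⁺‖_{H¹}²))`. -/
theorem implicit_step_local_coordinates :
    ∃ R τ₀ C : ℝ, 0 < R ∧ 0 < τ₀ ∧ 0 < C ∧
      ∀ τ : ℝ, 0 < τ → τ ≤ τ₀ →
      ∀ ψ ψs : ℝ → ℝ,
        (∀ x, ψ (-x) = ψ x) → Differentiable ℝ ψ →
        Integrable (fun x => (ψ x)^2) → Integrable (fun x => (deriv ψ x)^2) →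
        (∫ x : ℝ, (ψ x)^2) = 1 →
        Real.sqrt (H1sq (fun x => ψ x - eta x)) < R →
        (∀ x, ψs (-x) = ψs x) →
        Differentiable ℝ ψs → Differentiable ℝ (deriv ψs) →
        Differentiable ℝ (deriv (deriv ψs)) →
        Integrable (fun x => (ψs x)^2) → Integrable (fun x => (deriv ψs x)^2) →
        Integrable (fun x => (deriv (deriv ψs) x)^2) →
        Integrable (fun x => (deriv (deriv (deriv ψs)) x)^2) →
        (∀ x : ℝ, ψs x = ψ x + τ * ((1/2) * deriv (deriv ψs) x + (ψ x)^2 * ψs x)) →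
        0 < Real.sqrt (∫ x : ℝ, (ψs x)^2) →
        -- `ψ⁺` is the normalization of `ψ*`; `u, u⁺` the coordinates orthogonal to `η`
        (let ψp : ℝ → ℝ := fun x => ψs x / Real.sqrt (∫ y : ℝ, (ψs y)^2)
         let u : ℝ → ℝ := fun x => ψ x - (∫ y : ℝ, ψ y * eta y) * eta x
         let up : ℝ → ℝ := fun x => ψp x - (∫ y : ℝ, ψp y * eta y) * eta x
         Real.sqrt (H1sq (fun x => up x - u x -
            τ * PW (fun y => (1/2) * deriv (deriv up) y - (1/8) * u y +
              (eta y)^2 * up y + 2 * (eta y)^2 * u y) x)) ≤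
          C * τ * (H1sq u + H1sq up)) := by
  refine ⟨1/100, 1/100, 500, by norm_num, by norm_num, by norm_num, ?_⟩
  intro τ hτ hτ' ψ ψs _ dψ iψ iψ' nψ hR _ ds ds' ds'' is is' is'' _ eqn hN
  obtain ⟨N, hNdef⟩ : ∃ N, N = Real.sqrt (∫ x : ℝ, (ψs x)^2) := ⟨_, rfl⟩
  rw [← hNdef] at hN ⊢
  intro ψp u up
  have hs : MemH1 ψs := .of_integrable ds is is'
  have hs' : MemH1 (deriv ψs) := .of_integrable ds' is' is''
  have e : ψp = fun x => N⁻¹ * ψs x := funext fun x => div_eq_inv_mul _ _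
  have e' : deriv ψp = fun x => N⁻¹ * deriv ψs x := by rw [e]; exact hs.deriv_const_mul_eq _
  have e'' : deriv (deriv ψp) = fun x => N⁻¹ * deriv (deriv ψs) x := by
    rw [e']; exact hs'.deriv_const_mul_eq _
  have key := normalized_step_h1norm_le (ψ := ψ) (p := ψp) (u := u) (v := up) (κ := N⁻¹) hτ hτ'
    (inv_pos.2 hN) (.of_integrable dψ iψ iψ') (e ▸ hs.const_mul _) (e' ▸ hs'.const_mul _)
    (by rw [l2norm, nψ, Real.sqrt_one])
    (by rw [e, l2norm_const_mul, l2norm, ← hNdef, abs_of_pos (inv_pos.2 hN), inv_mul_cancel₀ hN.ne'])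
    hR.le (fun x => by rw [e'']; simp only [e]; linear_combination N⁻¹ * eqn x) rfl rfl
  rw [h1norm_sq, h1norm_sq] at key
  exact key
end
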